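/- arXiv:2210.05887 — 6 statements merged into one kernel-verified Lean document; each statement's English description precedes it below -/
import Mathlib

section
/- Let X and Y be real Banach spaces and let H be a closed subspace of L(X,Y) such that the rank-one operator x* ⊗ y belongs to H for every x* ∈ X* and y ∈ Y. Then the norm of H is non-rough if and only if the norm of X* is non-rough and the norm of Y is non-rough. -/
set_option synthInstance.maxHeartbeats 1000000
set_option maxHeartbeats 1000000
set_option maxSynthPendingDepth 3

open Metric Set Filter

noncomputable section

/-- A Banach space `Z` has the **Ball Dentable Property** (`BDP`) if its closed unit ball
has slices of arbitrarily small diameter. -/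
def BallDentableProperty (Z : Type*) [NormedAddCommGroup Z] [NormedSpace ℝ Z] : Prop :=
  ∀ ε : ℝ, 0 < ε → ∃ (f : StrongDual ℝ Z) (α : ℝ), ‖f‖ = 1 ∧ 0 < α ∧ α < 1 ∧
    Metric.diam {z : Z | ‖z‖ ≤ 1 ∧ 1 - α < f z} < ε

/-- The dual `Z*` of a Banach space `Z` has the **w*-Ball Dentable Property** (`w*-BDP`) if the
closed unit ball of `Z*` has weak-star slices (slices given by elements of the predual `Z`)
of arbitrarily small diameter. -/
def WStarBallDentableProperty (Z : Type*) [NormedAddCommGroup Z] [NormedSpace ℝ Z] : Prop :=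
  ∀ ε : ℝ, 0 < ε → ∃ (z : Z) (α : ℝ), ‖z‖ = 1 ∧ 0 < α ∧ α < 1 ∧
    Metric.diam {f : StrongDual ℝ Z | ‖f‖ ≤ 1 ∧ 1 - α < f z} < ε

/-- A Banach space `Z` has the **Ball Small Combination of Slices Property** (`BSCSP`) if its
closed unit ball has convex combinations of slices of arbitrarily small diameter. -/
def BallSCSProperty (Z : Type*) [NormedAddCommGroup Z] [NormedSpace ℝ Z] : Prop :=
  ∀ ε : ℝ, 0 < ε → ∃ (n : ℕ) (lam : Fin (n + 1) → ℝ) (f : Fin (n + 1) → StrongDual ℝ Z)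
    (α : Fin (n + 1) → ℝ),
    (∀ i, 0 < lam i) ∧ (∑ i, lam i = 1) ∧ (∀ i, ‖f i‖ = 1) ∧ (∀ i, 0 < α i ∧ α i < 1) ∧
    Metric.diam {z : Z | ∃ g : Fin (n + 1) → Z,
      (∀ i, ‖g i‖ ≤ 1 ∧ 1 - α i < f i (g i)) ∧ z = ∑ i, lam i • g i} < ε

/-- The dual `Z*` of a Banach space `Z` has the **w*-Ball Small Combination of Slices Property**
(`w*-BSCSP`) if the closed unit ball of `Z*` has convex combinations of weak-star slices
(slices given by elements of the predual `Z`) of arbitrarily small diameter. -/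
def WStarBallSCSProperty (Z : Type*) [NormedAddCommGroup Z] [NormedSpace ℝ Z] : Prop :=
  ∀ ε : ℝ, 0 < ε → ∃ (n : ℕ) (lam : Fin (n + 1) → ℝ) (z : Fin (n + 1) → Z)
    (α : Fin (n + 1) → ℝ),
    (∀ i, 0 < lam i) ∧ (∑ i, lam i = 1) ∧ (∀ i, ‖z i‖ = 1) ∧ (∀ i, 0 < α i ∧ α i < 1) ∧
    Metric.diam {φ : StrongDual ℝ Z | ∃ g : Fin (n + 1) → StrongDual ℝ Z,
      (∀ i, ‖g i‖ ≤ 1 ∧ 1 - α i < g i (z i)) ∧ φ = ∑ i, lam i • g i} < ε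

/-- The roughness `η(Z, u)` of the norm of `Z` at `u`:
`limsup_{‖h‖ → 0} (‖u + h‖ + ‖u - h‖ - 2) / ‖h‖`. -/
noncomputable def roughness (Z : Type*) [NormedAddCommGroup Z] (u : Z) : ℝ :=
  Filter.limsup (fun h : Z => (‖u + h‖ + ‖u - h‖ - 2) / ‖h‖) (nhdsWithin 0 {(0 : Z)}ᶜ)

/-- The norm of `Z` is **rough** if it is `ε`-rough for some `ε > 0`, i.e. there is `ε > 0`
with `η(Z, u) ≥ ε` for every `u` in the unit sphere of `Z`. -/
def RoughNorm (Z : Type*) [NormedAddCommGroup Z] : Prop :=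
  ∃ ε : ℝ, 0 < ε ∧ ∀ u : Z, ‖u‖ = 1 → ε ≤ roughness Z u

/-- The norm of `Z` is **non-rough** if it is not rough. -/
def NonRoughNorm (Z : Type*) [NormedAddCommGroup Z] : Prop := ¬ RoughNorm Z

/-- The rank-one operator `x* ⊗ y : E → F`, `x ↦ x*(x) • y`. -/
noncomputable def rankOneOp {E F : Type*} [NormedAddCommGroup E] [NormedSpace ℝ E]
    [NormedAddCommGroup F] [NormedSpace ℝ F] (f : StrongDual ℝ E) (y : F) : E →L[ℝ] F :=
  f.smulRight y

/-- For a subspace `H ⊆ L(E, F)`, a vector `x ∈ E` and a functional `g ∈ F*`, the functional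
`x ⊗ g ∈ H*` given by `T ↦ g (T x)`. -/
noncomputable def dualTensorFunctional {E F : Type*} [NormedAddCommGroup E] [NormedSpace ℝ E]
    [NormedAddCommGroup F] [NormedSpace ℝ F] (H : Submodule ℝ (E →L[ℝ] F)) (x : E)
    (g : StrongDual ℝ F) : StrongDual ℝ H :=
  g.comp ((ContinuousLinearMap.apply ℝ F x).comp H.subtypeL)

/-- The weak-star closed convex hull of a subset `S` of the dual `Z*`. -/
noncomputable def wStarClosedConvexHull (Z : Type*) [NormedAddCommGroup Z] [NormedSpace ℝ Z]
    (S : Set (StrongDual ℝ Z)) : Set (StrongDual ℝ Z) :=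
  StrongDual.toWeakDual ⁻¹'
    closure (convexHull ℝ (StrongDual.toWeakDual '' S))

/-- `D(Z, u)`: the set of norm-at-most-one functionals attaining the value `1` at `u`. -/
def dualFace (Z : Type*) [NormedAddCommGroup Z] [NormedSpace ℝ Z] (u : Z) :
    Set (StrongDual ℝ Z) := {h | ‖h‖ ≤ 1 ∧ h u = 1}

/-- `n(Z, u)`: the largest non-negative `k` such that
`k * ‖z‖ ≤ sup {|f z| : f ∈ D(Z, u)}` for every `z ∈ Z`. -/
noncomputable def nConstant (Z : Type*) [NormedAddCommGroup Z] [NormedSpace ℝ Z] (u : Z) : ℝ :=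
  sSup {k : ℝ | 0 ≤ k ∧ ∀ z : Z, k * ‖z‖ ≤ ⨆ f : dualFace Z u, |f.1 z|}

/-- The Banach space `B(X × Y)` of bounded bilinear forms on `X × Y`, realized as
`X →L[ℝ] Y →L[ℝ] ℝ`. -/
def BoundedBilinearForms (X Y : Type*) [NormedAddCommGroup X] [NormedSpace ℝ X]
    [NormedAddCommGroup Y] [NormedSpace ℝ Y] : Type _ :=
  X →L[ℝ] Y →L[ℝ] ℝ

noncomputable instance {X Y : Type*} [NormedAddCommGroup X] [NormedSpace ℝ X]
    [NormedAddCommGroup Y] [NormedSpace ℝ Y] : NormedAddCommGroup (BoundedBilinearForms X Y) :=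
  inferInstanceAs (NormedAddCommGroup (X →L[ℝ] Y →L[ℝ] ℝ))

noncomputable instance {X Y : Type*} [NormedAddCommGroup X] [NormedSpace ℝ X]
    [NormedAddCommGroup Y] [NormedSpace ℝ Y] : NormedSpace ℝ (BoundedBilinearForms X Y) :=
  inferInstanceAs (NormedSpace ℝ (X →L[ℝ] Y →L[ℝ] ℝ))

/-- The canonical image of the elementary tensor `x ⊗ y` in the dual of the space of bounded
bilinear forms on `X × Y`; it acts by `B ↦ B x y`. -/
noncomputable def projTensorElem {X Y : Type*} [NormedAddCommGroup X] [NormedSpace ℝ X]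
    [NormedAddCommGroup Y] [NormedSpace ℝ Y] (x : X) (y : Y) :
    StrongDual ℝ (BoundedBilinearForms X Y) :=
  (ContinuousLinearMap.apply ℝ ℝ y).comp (ContinuousLinearMap.apply ℝ (Y →L[ℝ] ℝ) x)

/-- The projective tensor product `X ⊗̂_π Y`, realized canonically (and isometrically) as the
closure of the span of the elementary tensors inside the dual of the Banach space of bounded
bilinear forms on `X × Y`.  (On elementary tensor combinations the dual norm coincides with the
projective norm, so this closed subspace is the canonical isometric copy of the completion
`X ⊗̂_π Y`.) -/
noncomputable def ProjectiveTensorProduct (X Y : Type*) [NormedAddCommGroup X] [NormedSpace ℝ X]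
    [NormedAddCommGroup Y] [NormedSpace ℝ Y] :
    Submodule ℝ (StrongDual ℝ (BoundedBilinearForms X Y)) :=
  (Submodule.span ℝ {φ | ∃ x y, φ = projTensorElem x y}).topologicalClosure

/-- The projective tensor product `X ⊗̂_π Y` as a Banach space. -/
def ProjectiveTensorSpace (X Y : Type*) [NormedAddCommGroup X] [NormedSpace ℝ X]
    [NormedAddCommGroup Y] [NormedSpace ℝ Y] : Type _ :=
  ↥(ProjectiveTensorProduct X Y)

noncomputable instance {X Y : Type*} [NormedAddCommGroup X] [NormedSpace ℝ X]
    [NormedAddCommGroup Y] [NormedSpace ℝ Y] : NormedAddCommGroup (ProjectiveTensorSpace X Y) :=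
  inferInstanceAs (NormedAddCommGroup ↥(ProjectiveTensorProduct X Y))

noncomputable instance {X Y : Type*} [NormedAddCommGroup X] [NormedSpace ℝ X]
    [NormedAddCommGroup Y] [NormedSpace ℝ Y] : NormedSpace ℝ (ProjectiveTensorSpace X Y) :=
  inferInstanceAs (NormedSpace ℝ ↥(ProjectiveTensorProduct X Y))

/-- The rank-one operator `x ⊗ y : X* → Y`, `x* ↦ x*(x) • y`. -/
noncomputable def injTensorElem {X Y : Type*} [NormedAddCommGroup X] [NormedSpace ℝ X]
    [NormedAddCommGroup Y] [NormedSpace ℝ Y] (x : X) (y : Y) :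
    StrongDual ℝ X →L[ℝ] Y :=
  (ContinuousLinearMap.apply ℝ ℝ x).smulRight y

/-- The injective tensor product `X ⊗̂_ε Y`, realized canonically (and isometrically) as the
closure of the span of the rank-one operators `x ⊗ y` inside the Banach space `L(X*, Y)`.
(On elementary tensor combinations the operator norm coincides with the injective norm, so this
closed subspace is the canonical isometric copy of the completion `X ⊗̂_ε Y`.) -/
noncomputable def InjectiveTensorProduct (X Y : Type*) [NormedAddCommGroup X] [NormedSpace ℝ X]
    [NormedAddCommGroup Y] [NormedSpace ℝ Y] :
    Submodule ℝ (StrongDual ℝ X →L[ℝ] Y) :=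
  (Submodule.span ℝ {T | ∃ x y, T = injTensorElem x y}).topologicalClosure

/-- The injective tensor product `X ⊗̂_ε Y` as a Banach space. -/
def InjectiveTensorSpace (X Y : Type*) [NormedAddCommGroup X] [NormedSpace ℝ X]
    [NormedAddCommGroup Y] [NormedSpace ℝ Y] : Type _ :=
  ↥(InjectiveTensorProduct X Y)

noncomputable instance {X Y : Type*} [NormedAddCommGroup X] [NormedSpace ℝ X]
    [NormedAddCommGroup Y] [NormedSpace ℝ Y] : NormedAddCommGroup (InjectiveTensorSpace X Y) :=
  inferInstanceAs (NormedAddCommGroup ↥(InjectiveTensorProduct X Y))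

noncomputable instance {X Y : Type*} [NormedAddCommGroup X] [NormedSpace ℝ X]
    [NormedAddCommGroup Y] [NormedSpace ℝ Y] : NormedSpace ℝ (InjectiveTensorSpace X Y) :=
  inferInstanceAs (NormedSpace ℝ ↥(InjectiveTensorProduct X Y))

end


/-- Quantitative smallness of the roughness at `u`. -/
def SmoothAt (Z : Type*) [NormedAddCommGroup Z] (u : Z) (ε : ℝ) : Prop :=
  ∃ δ : ℝ, 0 < δ ∧ ∀ h : Z, ‖h‖ ≤ δ → ‖u + h‖ + ‖u - h‖ ≤ 2 + ε * ‖h‖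

lemma smoothAt_of_roughness_lt {Z : Type*} [NormedAddCommGroup Z]
    {u : Z} (hu : ‖u‖ = 1) {ε : ℝ} (h : roughness Z u < ε) : SmoothAt Z u ε := by
  have hb : IsBoundedUnder (· ≤ ·) (nhdsWithin 0 {(0 : Z)}ᶜ)
      (fun h : Z => (‖u + h‖ + ‖u - h‖ - 2) / ‖h‖) := by
    refine ⟨2, Filter.eventually_map.2 (Filter.Eventually.of_forall fun h => ?_)⟩
    apply div_le_of_le_mul₀ (norm_nonneg _) (by norm_num)
    have h1 := norm_add_le u h
    have h2 := norm_sub_le u h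
    linarith
  have he := eventually_lt_of_limsup_lt h hb
  rw [eventually_nhdsWithin_iff, Metric.eventually_nhds_iff] at he
  obtain ⟨δ, hδ, H⟩ := he
  refine ⟨δ / 2, by positivity, fun k hk => ?_⟩
  by_cases hk0 : k = 0
  · subst hk0; simp [hu]; norm_num
  · have h1 := H (y := k) (by rw [dist_zero_right]; linarith) (by simpa using hk0)
    rw [div_lt_iff₀ (norm_pos_iff.2 hk0)] at h1
    linarith

lemma roughness_le_of_smoothAt {Z : Type*} [NormedAddCommGroup Z] [NormedSpace ℝ Z]
    {u : Z} (hu : ‖u‖ = 1) {ε : ℝ} (h : SmoothAt Z u ε) : roughness Z u ≤ ε := by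
  have hnt : Nontrivial Z := ⟨u, 0, by rintro rfl; simp at hu⟩
  have hne : (nhdsWithin (0 : Z) {(0 : Z)}ᶜ).NeBot := Module.punctured_nhds_neBot ℝ Z 0
  have hb : IsBoundedUnder (· ≥ ·) (nhdsWithin 0 {(0 : Z)}ᶜ)
      (fun h : Z => (‖u + h‖ + ‖u - h‖ - 2) / ‖h‖) := by
    refine ⟨0, Filter.eventually_map.2 (Filter.Eventually.of_forall fun h => ?_)⟩
    apply div_nonneg _ (norm_nonneg _)
    have h1 := norm_add_le (u + h) (u - h)
    have h2 : (u + h) + (u - h) = (2 : ℝ) • u := by rw [two_smul]; abel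
    rw [h2, norm_smul, hu] at h1
    norm_num at h1
    linarith
  obtain ⟨δ, hδ, H⟩ := h
  refine limsup_le_of_le hb.isCoboundedUnder_le ?_
  rw [eventually_nhdsWithin_iff, Metric.eventually_nhds_iff]
  refine ⟨δ, hδ, fun k hk hk0 => ?_⟩
  rw [dist_zero_right] at hk
  rw [div_le_iff₀ (norm_pos_iff.2 hk0)]
  linarith [H k hk.le]

lemma nonRough_iff {Z : Type*} [NormedAddCommGroup Z] [NormedSpace ℝ Z] :
    NonRoughNorm Z ↔ ∀ ε : ℝ, 0 < ε → ∃ u : Z, ‖u‖ = 1 ∧ SmoothAt Z u ε := by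
  unfold NonRoughNorm RoughNorm
  constructor
  · intro h ε hε
    by_contra hc
    push Not at hc
    refine h ⟨ε, hε, fun u hu => ?_⟩
    by_contra hl
    exact hc u hu (smoothAt_of_roughness_lt hu (not_le.1 hl))
  · rintro h ⟨ε, hε, H⟩
    obtain ⟨u, hu, hs⟩ := h (ε / 2) (by positivity)
    have h1 := H u hu
    have h2 := roughness_le_of_smoothAt hu hs
    linarith

/-- By convexity it suffices to check one radius. -/
lemma smoothAt_of_sphere {Z : Type*} [NormedAddCommGroup Z] [NormedSpace ℝ Z]
    {u : Z} (hu : ‖u‖ = 1) {ε δ : ℝ} (hδ : 0 < δ)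
    (H : ∀ h : Z, ‖h‖ = δ → ‖u + h‖ + ‖u - h‖ ≤ 2 + ε * δ) : SmoothAt Z u ε := by
  refine ⟨δ, hδ, fun h hh => ?_⟩
  by_cases h0 : h = 0
  · subst h0; simp [hu]; norm_num
  have hp : 0 < ‖h‖ := norm_pos_iff.2 h0
  set s : ℝ := ‖h‖ / δ with hs
  have hs0 : 0 < s := by positivity
  have hs1 : s ≤ 1 := by rw [hs, div_le_one hδ]; exact hh
  set k : Z := s⁻¹ • h with hk
  have hkn : ‖k‖ = δ := by
    rw [hk, norm_smul, norm_inv, Real.norm_of_nonneg hs0.le, hs]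
    field_simp
  have hhk : h = s • k := by rw [hk, smul_inv_smul₀ hs0.ne']
  have e1 : u + h = (1 - s) • u + s • (u + k) := by rw [hhk]; module
  have e2 : u - h = (1 - s) • u + s • (u - k) := by rw [hhk]; module
  have n1 : ‖u + h‖ ≤ (1 - s) + s * ‖u + k‖ := by
    rw [e1]
    refine (norm_add_le _ _).trans ?_
    rw [norm_smul, norm_smul, hu, Real.norm_of_nonneg hs0.le,
      Real.norm_of_nonneg (by linarith : 0 ≤ 1 - s), mul_one]
  have n2 : ‖u - h‖ ≤ (1 - s) + s * ‖u - k‖ := by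
    rw [e2]
    refine (norm_add_le _ _).trans ?_
    rw [norm_smul, norm_smul, hu, Real.norm_of_nonneg hs0.le,
      Real.norm_of_nonneg (by linarith : 0 ≤ 1 - s), mul_one]
  have h3 := mul_le_mul_of_nonneg_left (H k hkn) hs0.le
  have h4 : s * δ = ‖h‖ := by rw [hs]; field_simp
  have h5 : s * (2 + ε * δ) = 2 * s + ε * ‖h‖ := by rw [← h4]; ring
  linarith

/-- Šmulyan-type lemma: weak-star slices are small. -/
lemma slice_of_smoothAt {Z : Type*} [NormedAddCommGroup Z] [NormedSpace ℝ Z]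
    {u : Z} {ε : ℝ} (hε : 0 < ε) (h : SmoothAt Z u ε) :
    ∃ α : ℝ, 0 < α ∧ ∀ p q : StrongDual ℝ Z, ‖p‖ ≤ 1 → ‖q‖ ≤ 1 →
      1 - α < p u → 1 - α < q u → ‖p - q‖ ≤ 2 * ε := by
  obtain ⟨δ, hδ, H⟩ := h
  refine ⟨ε * δ / 2, by positivity, fun p q hp hq hpu hqu => ?_⟩
  have key : ∀ k : Z, ‖k‖ = δ → (p - q) k ≤ 2 * ε * δ := by
    intro k hk
    have h1 := H k hk.le
    have h2 : p (u + k) ≤ ‖u + k‖ := (le_abs_self _).trans (p.le_of_opNorm_le hp _ |>.trans (by simp))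
    have h3 : q (u - k) ≤ ‖u - k‖ := (le_abs_self _).trans (q.le_of_opNorm_le hq _ |>.trans (by simp))
    rw [hk] at h1
    simp only [map_add, map_sub] at h2 h3
    simp only [ContinuousLinearMap.sub_apply]
    linarith
  refine ContinuousLinearMap.opNorm_le_bound _ (by positivity) fun z => ?_
  by_cases hz : z = 0
  · subst hz; simp
  have hz' : 0 < ‖z‖ := norm_pos_iff.2 hz
  have hn : ‖(δ / ‖z‖) • z‖ = δ := by
    rw [norm_smul, Real.norm_of_nonneg (by positivity)]; field_simp
  have a1 := key _ hn
  have a2 := key (-((δ / ‖z‖) • z)) (by rw [norm_neg, hn])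
  rw [map_neg] at a2
  rw [map_smul, smul_eq_mul] at a1 a2
  have a3 : |δ / ‖z‖ * (p - q) z| ≤ 2 * ε * δ := abs_le.2 ⟨by linarith, a1⟩
  rw [abs_mul, abs_of_pos (by positivity : 0 < δ / ‖z‖), div_mul_eq_mul_div,
    div_le_iff₀ hz'] at a3
  rw [Real.norm_eq_abs]
  have : δ * |(p - q) z| ≤ δ * (2 * ε * ‖z‖) := by linarith
  exact le_of_mul_le_mul_left this hδ

lemma norm_rankOneOp {E F : Type*} [NormedAddCommGroup E] [NormedSpace ℝ E]
    [NormedAddCommGroup F] [NormedSpace ℝ F] (f : StrongDual ℝ E) (y : F) :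
    ‖rankOneOp f y‖ = ‖f‖ * ‖y‖ := ContinuousLinearMap.norm_smulRight_apply f y

/-- A bounded operator almost attains its norm on the unit sphere-ish. -/
lemma exists_near {X Y : Type*} [NormedAddCommGroup X] [NormedSpace ℝ X]
    [NormedAddCommGroup Y] [NormedSpace ℝ Y] (U : X →L[ℝ] Y) {γ : ℝ} (hγ : 0 < γ) :
    ∃ x : X, ‖x‖ ≤ 1 ∧ ‖U‖ - γ < ‖U x‖ := by
  by_contra hc
  push Not at hc
  rcases le_or_gt (‖U‖ - γ) 0 with h | h
  · by_cases h' : ‖U‖ - γ = 0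
    · have : ‖U‖ ≤ 0 := by
        refine ContinuousLinearMap.opNorm_le_of_unit_norm le_rfl fun x hx => ?_
        exact (hc x hx.le).trans h
      linarith
    · have := hc 0 (by simp)
      simp at this
      exact h' (le_antisymm h (by linarith))
  · have := ContinuousLinearMap.opNorm_le_of_unit_norm h.le (f := U) fun x hx => hc x hx.le
    linarith

lemma exists_slice {X Y : Type*} [NormedAddCommGroup X] [NormedSpace ℝ X]
    [NormedAddCommGroup Y] [NormedSpace ℝ Y] (f : StrongDual ℝ X) (y : Y)
    (hf : ‖f‖ = 1) (hy : ‖y‖ = 1) {α : ℝ} (hα1 : α ≤ 1)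
    (U : X →L[ℝ] Y) {γ : ℝ} (hγ : 0 < γ)
    (hU : 2 * ‖U - rankOneOp f y‖ + γ ≤ α) :
    ∃ (x : X) (p : StrongDual ℝ Y), ‖x‖ ≤ 1 ∧ ‖p‖ ≤ 1 ∧ ‖U‖ - γ < p (U x) ∧
      1 - α < f x ∧ 1 - α < p y := by
  obtain ⟨x, hx, hUx⟩ := exists_near U hγ
  obtain ⟨p, hp, hpU⟩ := exists_dual_vector'' ℝ (U x)
  simp only [RCLike.ofReal_real_eq_id, id_eq] at hpU
  have hT : ‖rankOneOp f y‖ = 1 := by rw [norm_rankOneOp, hf, hy, one_mul]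
  have hUT : 1 - ‖U - rankOneOp f y‖ ≤ ‖U‖ := by
    have := norm_sub_norm_le (rankOneOp f y) U
    rw [hT, norm_sub_rev] at this
    linarith
  have h1 : p ((U - rankOneOp f y) x) ≤ ‖U - rankOneOp f y‖ := by
    refine (le_abs_self _).trans ((p.le_of_opNorm_le hp _).trans ?_)
    rw [one_mul]
    exact ((U - rankOneOp f y).le_opNorm x).trans (mul_le_of_le_one_right (norm_nonneg _) hx)
  have h2 : p ((U - rankOneOp f y) x) = p (U x) - f x * p y := by
    simp [rankOneOp]
  have hprod : 1 - α < f x * p y := by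
    rw [h2, hpU] at h1
    linarith
  have hfx : |f x| ≤ 1 := (f.le_opNorm x).trans (by rw [hf, one_mul]; exact hx)
  have hpy : |p y| ≤ 1 := (p.le_opNorm y).trans (by rw [hy, mul_one]; exact hp)
  rw [abs_le] at hfx hpy
  rcases le_or_gt 0 (f x) with hs | hs
  · have hpy0 : 0 < p y := by
      by_contra hcon
      nlinarith
    refine ⟨x, p, hx, hp, by rw [hpU]; exact hUx, by nlinarith, by nlinarith⟩
  · have hpy0 : p y < 0 := by
      by_contra hcon
      nlinarith
    refine ⟨-x, -p, by rwa [norm_neg], by rwa [norm_neg], ?_, ?_, ?_⟩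
    · simp only [map_neg, ContinuousLinearMap.neg_apply, neg_neg, hpU]; exact hUx
    · rw [map_neg]; nlinarith
    · rw [ContinuousLinearMap.neg_apply]; nlinarith

/-- Hard direction at a point. -/
lemma smoothAt_rankOne {X Y : Type*} [NormedAddCommGroup X] [NormedSpace ℝ X]
    [NormedAddCommGroup Y] [NormedSpace ℝ Y] (f : StrongDual ℝ X) (y : Y)
    (hf : ‖f‖ = 1) (hy : ‖y‖ = 1) {ε : ℝ} (hε : 0 < ε)
    (hsf : SmoothAt (StrongDual ℝ X) f ε) (hsy : SmoothAt Y y ε) :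
    SmoothAt (X →L[ℝ] Y) (rankOneOp f y) (4 * ε) := by
  obtain ⟨a, ha, Ha⟩ := slice_of_smoothAt hε hsf
  obtain ⟨b, hb, Hb⟩ := slice_of_smoothAt hε hsy
  obtain ⟨α, hα, hαa, hαb, hα1⟩ : ∃ α : ℝ, 0 < α ∧ α ≤ a ∧ α ≤ b ∧ α ≤ 1 :=
    ⟨min a (min b 1), by positivity, min_le_left _ _,
      (min_le_right _ _).trans (min_le_left _ _), (min_le_right _ _).trans (min_le_right _ _)⟩
  set T := rankOneOp f y with hTdef
  have hT : ‖T‖ = 1 := by rw [hTdef, norm_rankOneOp, hf, hy, one_mul]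
  refine ⟨α / 4, by positivity, fun S hS => ?_⟩
  refine le_of_forall_pos_le_add fun γ hγ => ?_
  obtain ⟨c, hc, hcγ, hcα⟩ : ∃ c : ℝ, 0 < c ∧ 2 * c ≤ γ ∧ c ≤ α / 2 :=
    ⟨min (γ / 2) (α / 2), by positivity, by linarith [min_le_left (γ / 2) (α / 2)],
      min_le_right _ _⟩
  obtain ⟨x₁, p₁, hx₁, hp₁, h₁, hfx₁, hpy₁⟩ := exists_slice f y hf hy hα1 (T + S) hc
    (by rw [← hTdef, add_sub_cancel_left]; linarith)
  obtain ⟨x₂, p₂, hx₂, hp₂, h₂, hfx₂, hpy₂⟩ := exists_slice f y hf hy hα1 (T - S) hc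
    (by rw [← hTdef, sub_sub_cancel_left, norm_neg]; linarith)
  have hp : ‖p₁ - p₂‖ ≤ 2 * ε := Hb p₁ p₂ hp₁ hp₂ (by linarith) (by linarith)
  have hx : ‖x₁ - x₂‖ ≤ 2 * ε := by
    have := Ha (NormedSpace.inclusionInDoubleDual ℝ X x₁)
      (NormedSpace.inclusionInDoubleDual ℝ X x₂)
      ((NormedSpace.double_dual_bound ℝ X x₁).trans hx₁)
      ((NormedSpace.double_dual_bound ℝ X x₂).trans hx₂)
      (by rw [NormedSpace.dual_def]; linarith) (by rw [NormedSpace.dual_def]; linarith)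
    rw [← map_sub] at this
    have e := (NormedSpace.inclusionInDoubleDualLi (E := X) ℝ).norm_map (x₁ - x₂)
    exact e ▸ this
  have bound : ∀ (p : StrongDual ℝ Y) (V : X →L[ℝ] Y) (x : X),
      p (V x) ≤ ‖p‖ * (‖V‖ * ‖x‖) := fun p V x =>
    (le_abs_self _).trans ((p.le_opNorm _).trans
      (mul_le_mul_of_nonneg_left (V.le_opNorm x) (norm_nonneg _)))
  have t1 : p₁ (T x₁) ≤ 1 := by
    refine (bound _ _ _).trans ?_
    rw [hT, one_mul]
    exact mul_le_one₀ hp₁ (norm_nonneg _) hx₁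
  have t2 : p₂ (T x₂) ≤ 1 := by
    refine (bound _ _ _).trans ?_
    rw [hT, one_mul]
    exact mul_le_one₀ hp₂ (norm_nonneg _) hx₂
  have s1 : (p₁ - p₂) (S x₁) ≤ 2 * ε * ‖S‖ := by
    refine (bound _ _ _).trans ?_
    exact mul_le_mul hp (mul_le_of_le_one_right (norm_nonneg _) hx₁) (by positivity)
      (by positivity)
  have s2 : p₂ (S (x₁ - x₂)) ≤ 2 * ε * ‖S‖ := by
    refine (bound _ _ _).trans ?_
    have : ‖p₂‖ * (‖S‖ * ‖x₁ - x₂‖) ≤ 1 * (‖S‖ * (2 * ε)) := by gcongr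
    linarith
  simp only [ContinuousLinearMap.sub_apply, ContinuousLinearMap.add_apply, map_sub, map_add]
    at h₁ h₂ s1 s2
  linarith

/-- Corollary 2.7: if `H` is a closed subspace of `L(X, Y)` with `X* ⊗ Y ⊆ H`,
then the norm of `H` is non-rough if and only if the norms of `X*` and `Y` are non-rough. -/
theorem statement4 {X Y : Type*} [NormedAddCommGroup X] [NormedSpace ℝ X] [CompleteSpace X]
    [NormedAddCommGroup Y] [NormedSpace ℝ Y] [CompleteSpace Y]
    (H : Submodule ℝ (X →L[ℝ] Y)) (hH : IsClosed (H : Set (X →L[ℝ] Y)))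
    (hmem : ∀ (f : StrongDual ℝ X) (y : Y), rankOneOp f y ∈ H) :
    NonRoughNorm H ↔ NonRoughNorm (StrongDual ℝ X) ∧ NonRoughNorm Y := by
  rw [nonRough_iff, nonRough_iff, nonRough_iff]
  constructor
  · intro h
    -- common part: from a smooth point of `H` get good `x`, `p`
    have common : ∀ ε : ℝ, 0 < ε → ∃ (T : X →L[ℝ] Y) (δ : ℝ) (x : X), 0 < δ ∧ ‖T‖ = 1 ∧
        ‖x‖ ≤ 1 ∧ 1 - ‖T x‖ ≤ ε * δ / 2 ∧ 0 < ‖T x‖ ∧ ‖T x‖ ≤ 1 ∧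
        ∀ (f : StrongDual ℝ X) (y : Y), ‖f‖ * ‖y‖ ≤ δ →
          ‖T + rankOneOp f y‖ + ‖T - rankOneOp f y‖ ≤ 2 + ε * (‖f‖ * ‖y‖) := by
      intro ε hε
      obtain ⟨T, hT, δ, hδ, HT⟩ := h ε hε
      have hT' : ‖(T : X →L[ℝ] Y)‖ = 1 := hT
      obtain ⟨x, hx, hTx⟩ := exists_near (T : X →L[ℝ] Y) (γ := min (ε * δ / 2) (1 / 2))
        (by positivity)
      have m1 := min_le_left (ε * δ / 2) (1 / 2 : ℝ)
      have m2 := min_le_right (ε * δ / 2) (1 / 2 : ℝ)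
      refine ⟨T, δ, x, hδ, hT', hx, by linarith, by linarith, ?_, fun f y hfy => ?_⟩
      · exact ((T : X →L[ℝ] Y).le_opNorm x).trans (by rw [hT', one_mul]; exact hx)
      · have := HT ⟨rankOneOp f y, hmem f y⟩ (by
          change ‖rankOneOp f y‖ ≤ δ
          rwa [norm_rankOneOp])
        rw [← norm_rankOneOp]
        exact this
    constructor
    · intro ε hε
      obtain ⟨T, δ, x, hδ, hT, hx, hx1, hx0, hx2, HT⟩ := common (ε / 2) (by positivity)
      obtain ⟨p, hp, hpT⟩ := exists_dual_vector'' ℝ (T x)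
      simp only [RCLike.ofReal_real_eq_id, id_eq] at hpT
      set y : Y := ‖T x‖⁻¹ • T x with hy
      have hyn : ‖y‖ = 1 := by rw [hy, norm_smul, norm_inv, norm_norm, inv_mul_cancel₀ hx0.ne']
      have hpy : p y = 1 := by
        rw [hy, map_smul, hpT, smul_eq_mul, inv_mul_cancel₀ hx0.ne']
      set g : StrongDual ℝ X := p.comp T with hg
      have hgx : ‖T x‖ ≤ ‖g‖ := by
        have h1 : g x = ‖T x‖ := hpT
        rw [← h1]
        exact (le_abs_self _).trans ((g.le_opNorm x).trans
          (mul_le_of_le_one_right (norm_nonneg _) hx))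
      have hg1 : ‖g‖ ≤ 1 := by
        refine (ContinuousLinearMap.opNorm_comp_le p T).trans ?_
        rw [hT, mul_one]; exact hp
      have hg0 : 0 < ‖g‖ := by linarith
      set u : StrongDual ℝ X := ‖g‖⁻¹ • g with hu
      have hun : ‖u‖ = 1 := by rw [hu, norm_smul, norm_inv, norm_norm, inv_mul_cancel₀ hg0.ne']
      have hug : ‖u - g‖ = 1 - ‖g‖ := by
        have : u - g = (1 - ‖g‖) • u := by
          rw [sub_smul, one_smul, hu, smul_inv_smul₀ hg0.ne']
        rw [this, norm_smul, hun, Real.norm_of_nonneg (by linarith), mul_one]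
      refine ⟨u, hun, smoothAt_of_sphere hun hδ fun k hk => ?_⟩
      have H1 := HT k y (by rw [hyn, mul_one, hk])
      rw [hyn, mul_one, hk] at H1
      have c1 : g + k = p.comp (T + rankOneOp k y) := by
        ext z; simp [hg, rankOneOp, hpy]
      have c2 : g - k = p.comp (T - rankOneOp k y) := by
        ext z; simp [hg, rankOneOp, hpy]
      have d1 : ‖g + k‖ ≤ ‖T + rankOneOp k y‖ := by
        rw [c1]
        exact (ContinuousLinearMap.opNorm_comp_le _ _).trans
          (mul_le_of_le_one_left (norm_nonneg _) hp)
      have d2 : ‖g - k‖ ≤ ‖T - rankOneOp k y‖ := by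
        rw [c2]
        exact (ContinuousLinearMap.opNorm_comp_le _ _).trans
          (mul_le_of_le_one_left (norm_nonneg _) hp)
      have e1 : ‖u + k‖ ≤ ‖u - g‖ + ‖g + k‖ := by
        have := norm_add_le (u - g) (g + k)
        rwa [← add_assoc, sub_add_cancel] at this
      have e2 : ‖u - k‖ ≤ ‖u - g‖ + ‖g - k‖ := by
        have := norm_add_le (u - g) (g - k)
        rwa [sub_add_sub_cancel] at this
      linarith
    · intro ε hε
      obtain ⟨T, δ, x, hδ, hT, hx, hx1, hx0, hx2, HT⟩ := common (ε / 2) (by positivity)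
      have hxne : x ≠ 0 := by rintro rfl; simp at hx0
      have hxp : 0 < ‖x‖ := norm_pos_iff.2 hxne
      -- normalise `x`
      set w : X := ‖x‖⁻¹ • x with hw
      have hwn : ‖w‖ = 1 := by rw [hw, norm_smul, norm_inv, norm_norm, inv_mul_cancel₀ hxp.ne']
      have hTw : ‖T x‖ ≤ ‖T w‖ := by
        rw [hw, map_smul, norm_smul, norm_inv, norm_norm]
        exact le_mul_of_one_le_left (norm_nonneg _) ((one_le_inv₀ hxp).2 hx)
      have hTw1 : ‖T w‖ ≤ 1 := (T.le_opNorm w).trans (by rw [hT, hwn, one_mul])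
      have hTw0 : 0 < ‖T w‖ := by linarith
      obtain ⟨f, hf, hfw⟩ := exists_dual_vector ℝ w (by rw [← norm_ne_zero_iff, hwn]; norm_num)
      simp only [RCLike.ofReal_real_eq_id, id_eq, hwn] at hfw
      set g : Y := T w with hg
      set u : Y := ‖g‖⁻¹ • g with hu
      have hun : ‖u‖ = 1 := by rw [hu, norm_smul, norm_inv, norm_norm, inv_mul_cancel₀ hTw0.ne']
      have hug : ‖u - g‖ = 1 - ‖g‖ := by
        have : u - g = (1 - ‖g‖) • u := by
          rw [sub_smul, one_smul, hu, smul_inv_smul₀ hTw0.ne']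
        rw [this, norm_smul, hun, Real.norm_of_nonneg (by linarith), mul_one]
      refine ⟨u, hun, smoothAt_of_sphere hun hδ fun k hk => ?_⟩
      have H1 := HT f k (by rw [hf, one_mul, hk])
      rw [hf, one_mul, hk] at H1
      have d1 : ‖g + k‖ ≤ ‖T + rankOneOp f k‖ := by
        have := (T + rankOneOp f k).le_opNorm w
        simpa [rankOneOp, hfw, hwn] using this
      have d2 : ‖g - k‖ ≤ ‖T - rankOneOp f k‖ := by
        have := (T - rankOneOp f k).le_opNorm w
        simpa [rankOneOp, hfw, hwn] using this
      have e1 : ‖u + k‖ ≤ ‖u - g‖ + ‖g + k‖ := by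
        have := norm_add_le (u - g) (g + k)
        rwa [← add_assoc, sub_add_cancel] at this
      have e2 : ‖u - k‖ ≤ ‖u - g‖ + ‖g - k‖ := by
        have := norm_add_le (u - g) (g - k)
        rwa [sub_add_sub_cancel] at this
      linarith
  · rintro ⟨hX, hY⟩ ε hε
    obtain ⟨f, hf, hsf⟩ := hX (ε / 4) (by positivity)
    obtain ⟨y, hy, hsy⟩ := hY (ε / 4) (by positivity)
    obtain ⟨δ, hδ, HT⟩ := smoothAt_rankOne f y hf hy (by positivity : 0 < ε / 4) hsf hsy
    refine ⟨⟨rankOneOp f y, hmem f y⟩, ?_, δ, hδ, fun S hS => ?_⟩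
    · change ‖rankOneOp f y‖ = 1
      rw [norm_rankOneOp, hf, hy, one_mul]
    · have := HT (S : X →L[ℝ] Y) hS
      rw [mul_div_cancel₀ _ (by norm_num : (4 : ℝ) ≠ 0)] at this
      exact this
end

section
/- Let X and Y be real Banach spaces and let H be a closed subspace of L(X,Y) such that the rank-one operator x* ⊗ y belongs to H for every x* ∈ X* and y ∈ Y. If X has the Ball Dentable Property and Y* has the w*-Ball Small Combination of Slices Property, then H* has the w*-Ball Small Combination of Slices Property. -/
set_option synthInstance.maxHeartbeats 1000000
set_option maxHeartbeats 1000000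

open Metric Set Filter

theorem key_slice {X Y : Type*} [NormedAddCommGroup X] [NormedSpace ℝ X]
    [NormedAddCommGroup Y] [NormedSpace ℝ Y]
    {H : Type*} [NormedAddCommGroup H] [NormedSpace ℝ H] (J : H →ₗᵢ[ℝ] (X →L[ℝ] Y))
    (f : StrongDual ℝ X) (y : Y) (R : H) (hR : J R = rankOneOp f y) (hf : ‖f‖ = 1) (hy : ‖y‖ = 1)
    (α β t e : ℝ) (ht : 0 < t) (he : 0 < e) (he1 : e ≤ 1) (htα : 4 * t ≤ α) (htβ : 4 * t ≤ β)
    (ht1 : 4 * t < 1)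
    (φ : StrongDual ℝ H) (hφ : ‖φ‖ ≤ 1) (hs : 1 - t * e < φ R)
    (T : H) (hT : ‖T‖ ≤ 1) :
    ∃ (x : X) (g : StrongDual ℝ Y), ‖x‖ ≤ 1 ∧ 1 - α < f x ∧ ‖g‖ ≤ 1 ∧ 1 - β < g y ∧
      φ T ≤ g ((J T) x) + 2 * e := by
  have hη : 0 < t * e := mul_pos ht he
  have hte : t * e ≤ t := by nlinarith
  have hTn : ‖J T‖ ≤ 1 := by rwa [J.norm_map]
  have hx : ∃ x : X, ‖x‖ < 1 ∧ ‖R + t • T‖ - t * e < ‖(J (R + t • T)) x‖ :=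
    ContinuousLinearMap.exists_lt_apply_of_lt_opNorm (J (R + t • T))
      (show ‖R + t • T‖ - t * e < ‖J (R + t • T)‖ by rw [J.norm_map]; linarith)
  obtain ⟨x, hx1, hx2⟩ := hx
  obtain ⟨g, hg1, hg2⟩ := exists_dual_vector'' ℝ ((J (R + t • T)) x)
  have hexp : (J (R + t • T)) x = f x • y + t • (J T) x := by
    rw [map_add, map_smul, hR]; rfl
  have hg3 : g ((J (R + t • T)) x) = f x * g y + t * g ((J T) x) := by
    rw [hexp]; simp
  have hg4 : f x * g y + t * g ((J T) x) = ‖(J (R + t • T)) x‖ := by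
    rw [← hg3, hg2]; simp
  have hφ1 : φ (R + t • T) ≤ ‖R + t • T‖ := by
    have h1 := φ.le_of_opNorm_le hφ (R + t • T)
    have h2 := le_abs_self (φ (R + t • T))
    rw [Real.norm_eq_abs] at h1
    linarith
  have hφ2 : φ (R + t • T) = φ R + t * φ T := by simp
  have hφT : |φ T| ≤ 1 := by
    have h1 := φ.le_of_opNorm_le hφ T
    rw [Real.norm_eq_abs] at h1
    linarith
  have hTx : ‖(J T) x‖ ≤ 1 := by
    have h1 := (J T).le_of_opNorm_le hTn x
    linarith
  have hgT : |g ((J T) x)| ≤ 1 := by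
    have h1 := g.le_of_opNorm_le hg1 ((J T) x)
    rw [Real.norm_eq_abs] at h1
    linarith
  have hgy : |g y| ≤ 1 := by
    have h1 := g.le_of_opNorm_le hg1 y
    rw [Real.norm_eq_abs] at h1
    linarith
  have hfx : |f x| ≤ 1 := by
    have h1 := f.le_of_opNorm_le hf.le x
    rw [Real.norm_eq_abs] at h1
    linarith
  rw [abs_le] at hφT hgT hgy hfx
  have hprod : 1 - 4 * t < f x * g y := by nlinarith
  have hprod1 : f x * g y ≤ 1 := by nlinarith
  have hfin : φ T ≤ g ((J T) x) + 2 * e := by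
    have : t * φ T ≤ t * (g ((J T) x) + 2 * e) := by nlinarith
    exact le_of_mul_le_mul_left this ht
  rcases le_total 0 (f x) with h0 | h0
  · refine ⟨x, g, hx1.le, ?_, hg1, ?_, hfin⟩
    · nlinarith
    · have : 0 < g y := by
        by_contra hc
        nlinarith
      nlinarith
  · have : g y < 0 := by
      by_contra hc
      nlinarith
    refine ⟨-x, -g, by simpa using hx1.le, ?_, by simpa using hg1, ?_, by simpa using hfin⟩
    · rw [map_neg]; nlinarith
    · rw [ContinuousLinearMap.neg_apply]; nlinarith

theorem main_gen {X Y H : Type*} [NormedAddCommGroup X] [NormedSpace ℝ X]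
    [NormedAddCommGroup Y] [NormedSpace ℝ Y]
    [NormedAddCommGroup H] [NormedSpace ℝ H] (J : H →ₗᵢ[ℝ] (X →L[ℝ] Y))
    (hmem : ∀ (f : StrongDual ℝ X) (y : Y), ∃ R : H, J R = rankOneOp f y)
    (hX : BallDentableProperty X) (hY : WStarBallSCSProperty Y) :
    WStarBallSCSProperty H := by
  intro ε hε
  obtain ⟨e, he, he1, heε⟩ : ∃ e : ℝ, 0 < e ∧ e ≤ 1 ∧ 7 * e < ε :=
    ⟨min 1 (ε / 8), by positivity, min_le_left _ _, by
      have := min_le_right 1 (ε / 8); linarith⟩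
  obtain ⟨f, α, hf, hα0, hα1, hdX⟩ := hX e he
  obtain ⟨n, lam, y, β, hlam, hsum, hy, hβ, hdY⟩ := hY e he
  choose R hR using fun i => hmem f (y i)
  -- base point of the slice
  obtain ⟨x0, hx01, hx02⟩ : ∃ x0 : X, ‖x0‖ ≤ 1 ∧ 1 - α < f x0 := by
    obtain ⟨x, hx, hx'⟩ := ContinuousLinearMap.exists_lt_apply_of_lt_opNorm f
      (show 1 - α < ‖f‖ by linarith)
    rw [Real.norm_eq_abs] at hx'
    rcases le_total 0 (f x) with h | h
    · exact ⟨x, hx.le, by rwa [abs_of_nonneg h] at hx'⟩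
    · exact ⟨-x, by simpa using hx.le, by rw [abs_of_nonpos h] at hx'; simpa using hx'⟩
  have hbX : Bornology.IsBounded {z : X | ‖z‖ ≤ 1 ∧ 1 - α < f z} :=
    (Metric.isBounded_closedBall (x := (0 : X)) (r := 1)).subset
      (fun z hz => by simpa using hz.1)
  have hbY : Bornology.IsBounded {φ : StrongDual ℝ Y | ∃ g : Fin (n + 1) → StrongDual ℝ Y,
      (∀ i, ‖g i‖ ≤ 1 ∧ 1 - β i < g i (y i)) ∧ φ = ∑ i, lam i • g i} := by
    refine (Metric.isBounded_closedBall (x := (0 : StrongDual ℝ Y)) (r := 1)).subset ?_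
    rintro _ ⟨g, hg, rfl⟩
    rw [mem_closedBall_zero_iff]
    calc ‖∑ i, lam i • g i‖ ≤ ∑ i, ‖lam i • g i‖ := norm_sum_le _ _
      _ ≤ ∑ i, lam i := by
        refine Finset.sum_le_sum fun i _ => ?_
        rw [norm_smul, Real.norm_of_nonneg (hlam i).le]
        nlinarith [hlam i, (hg i).1]
      _ = 1 := hsum
  set t : Fin (n + 1) → ℝ := fun i => min α (β i) / 4 with htdef
  have ht : ∀ i, 0 < t i := fun i => by
    have := lt_min hα0 (hβ i).1
    simp only [htdef]; linarith
  have htα : ∀ i, 4 * t i ≤ α := fun i => by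
    have := min_le_left α (β i)
    simp only [htdef]; linarith
  have htβ : ∀ i, 4 * t i ≤ β i := fun i => by
    have := min_le_right α (β i)
    simp only [htdef]; linarith
  -- the one-sided estimate
  have key : ∀ (φ : Fin (n + 1) → StrongDual ℝ H),
      (∀ i, ‖φ i‖ ≤ 1 ∧ 1 - t i * e < φ i (R i)) →
      ∀ T : H, ‖T‖ ≤ 1 → ∃ g : Fin (n + 1) → StrongDual ℝ Y,
        (∀ i, ‖g i‖ ≤ 1 ∧ 1 - β i < g i (y i)) ∧
        (∑ i, lam i • φ i) T ≤ (∑ i, lam i • g i) ((J T) x0) + 3 * e := by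
    intro φ hφ T hT
    have h := fun i => key_slice J f (y i) (R i) (hR i) hf (hy i) α (β i) (t i) e (ht i) he he1
      (htα i) (htβ i) (by linarith [htα i]) (φ i) (hφ i).1 (hφ i).2 T hT
    choose x g hx1 hx2 hg1 hg2 hle using h
    refine ⟨g, fun i => ⟨hg1 i, hg2 i⟩, ?_⟩
    have hi : ∀ i, φ i T ≤ g i ((J T) x0) + 3 * e := by
      intro i
      have hd : ‖x i - x0‖ ≤ e := by
        rw [← dist_eq_norm]
        exact (Metric.dist_le_diam_of_mem hbX ⟨hx1 i, hx2 i⟩ ⟨hx01, hx02⟩).trans hdX.le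
      have h1 : ‖(J T) (x i - x0)‖ ≤ e := by
        have := (J T).le_of_opNorm_le (show ‖J T‖ ≤ 1 by rwa [J.norm_map]) (x i - x0)
        linarith
      have h2 := (g i).le_of_opNorm_le (hg1 i) ((J T) (x i - x0))
      rw [Real.norm_eq_abs, map_sub, map_sub] at h2
      have h3 := le_abs_self (g i ((J T) (x i)) - g i ((J T) x0))
      rw [map_sub] at h1
      linarith [hle i]
    simp only [ContinuousLinearMap.sum_apply, ContinuousLinearMap.smul_apply, smul_eq_mul]
    calc ∑ i, lam i * φ i T ≤ ∑ i, (lam i * g i ((J T) x0) + lam i * (3 * e)) := by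
          refine Finset.sum_le_sum fun i _ => ?_
          nlinarith [hi i, hlam i]
      _ = _ := by rw [Finset.sum_add_distrib, ← Finset.sum_mul, hsum, one_mul]
  refine ⟨n, lam, R, fun i => t i * e, hlam, hsum,
    ?_, ?_, ?_⟩
  · intro i
    rw [← J.norm_map, hR i, rankOneOp]
    rw [ContinuousLinearMap.norm_smulRight_apply, hf, hy i, one_mul]
  · intro i
    refine ⟨mul_pos (ht i) he, ?_⟩
    nlinarith [ht i, htα i]
  · refine lt_of_le_of_lt (Metric.diam_le_of_forall_dist_le (C := 7 * e) (by positivity) ?_) heε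
    rintro _ ⟨φ, hφ, rfl⟩ _ ⟨ψ, hψ, rfl⟩
    rw [dist_eq_norm]
    have one : ∀ T : H, ‖T‖ ≤ 1 →
        (∑ i, lam i • φ i - ∑ i, lam i • ψ i) T ≤ 7 * e := by
      intro T hT
      obtain ⟨g, hg, hgle⟩ := key φ hφ T hT
      obtain ⟨k, hk, hkle⟩ := key ψ hψ (-T) (by simpa using hT)
      have hd := (Metric.dist_le_diam_of_mem hbY ⟨g, hg, rfl⟩ ⟨k, hk, rfl⟩).trans hdY.le
      rw [dist_eq_norm] at hd
      have hTx : ‖(J T) x0‖ ≤ 1 := by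
        have := (J T).le_of_opNorm_le (show ‖J T‖ ≤ 1 by rwa [J.norm_map]) x0
        linarith
      have h2 := (∑ i, lam i • g i - ∑ i, lam i • k i).le_of_opNorm_le hd ((J T) x0)
      rw [Real.norm_eq_abs, ContinuousLinearMap.sub_apply] at h2
      have h3 := le_abs_self ((∑ i, lam i • g i) ((J T) x0) - (∑ i, lam i • k i) ((J T) x0))
      have h4 : (J (-T)) x0 = -(J T x0) := by rw [map_neg]; rfl
      rw [h4, map_neg, map_neg] at hkle
      rw [ContinuousLinearMap.sub_apply]
      nlinarith
    refine ContinuousLinearMap.opNorm_le_of_unit_norm (by positivity) fun T hT => ?_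
    rw [Real.norm_eq_abs, abs_le]
    have h1 := one T hT.le
    have h2 := one (-T) (by simpa using hT.le)
    rw [map_neg] at h2
    constructor <;> linarith

/-- Proposition 2.11: if `H` is a closed subspace of `L(X, Y)` with `X* ⊗ Y ⊆ H`,
`X` has the BDP and `Y*` has the `w*`-BSCSP, then `H*` has the `w*`-BSCSP. -/
theorem statement7 {X Y : Type*} [NormedAddCommGroup X] [NormedSpace ℝ X] [CompleteSpace X]
    [NormedAddCommGroup Y] [NormedSpace ℝ Y] [CompleteSpace Y]
    (H : Submodule ℝ (X →L[ℝ] Y)) (hH : IsClosed (H : Set (X →L[ℝ] Y)))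
    (hmem : ∀ (f : StrongDual ℝ X) (y : Y), rankOneOp f y ∈ H)
    (hX : BallDentableProperty X) (hY : WStarBallSCSProperty Y) :
    WStarBallSCSProperty H := by
  exact main_gen H.subtypeₗᵢ (fun f y => ⟨⟨rankOneOp f y, hmem f y⟩, rfl⟩) hX hY
end

section
/- Let X and Y be real Banach spaces such that the norm of Y is non-rough and X has the Ball Small Combination of Slices Property. Let H be a closed subspace of L(X,Y) such that the rank-one operator x* ⊗ y belongs to H for every x* ∈ X* and y ∈ Y. Then H* has the w*-Ball Small Combination of Slices Property. -/
set_option synthInstance.maxHeartbeats 1000000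
set_option maxHeartbeats 1000000
set_option maxSynthPendingDepth 3

open Metric Set Filter

theorem aux_smooth {Y : Type*} [NormedAddCommGroup Y] [NormedSpace ℝ Y]
    (hY : NonRoughNorm Y) (ε : ℝ) (hε : 0 < ε) :
    ∃ (y : Y) (δ : ℝ) (g : StrongDual ℝ Y), ‖y‖ = 1 ∧ 0 < δ ∧ ‖g‖ = 1 ∧
      ∀ h : Y, ‖h‖ < δ → ‖y + h‖ ≤ 1 + g h + ε * ‖h‖ := by
  unfold NonRoughNorm RoughNorm at hY
  push Not at hY
  obtain ⟨y, hy, hr⟩ := hY ε hε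
  have hbdd : IsBoundedUnder (· ≤ ·) (nhdsWithin (0 : Y) {(0 : Y)}ᶜ)
      (fun h : Y => (‖y + h‖ + ‖y - h‖ - 2) / ‖h‖) := by
    refine ⟨2, Filter.eventually_map.2 (Filter.Eventually.of_forall fun h => ?_)⟩
    refine div_le_of_le_mul₀ (norm_nonneg _) (by norm_num) ?_
    have h1 := norm_add_le y h
    have h2 := norm_sub_le y h
    linarith
  have hev := Filter.eventually_lt_of_limsup_lt hr hbdd
  rw [eventually_nhdsWithin_iff, Metric.eventually_nhds_iff] at hev
  obtain ⟨δ, hδ, hev⟩ := hev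
  have hy0 : ‖y‖ ≠ 0 := by rw [hy]; exact one_ne_zero
  obtain ⟨g, hg, hgy⟩ := exists_dual_vector ℝ y hy0
  have hgy' : g y = 1 := by simpa [hy] using hgy
  refine ⟨y, δ, g, hy, hδ, hg, fun h hh => ?_⟩
  by_cases h0 : h = 0
  · simp [h0, hy]
  have hpos : 0 < ‖h‖ := norm_pos_iff.2 h0
  have h1 := hev (by simpa using hh) h0
  rw [div_lt_iff₀ hpos] at h1
  have h2 : g (y - h) ≤ ‖y - h‖ := by
    have := g.le_opNorm (y - h)
    rw [hg, one_mul] at this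
    exact (le_abs_self _).trans this
  rw [map_sub, hgy'] at h2
  linarith

/-- A near-norming point of `f ⊗ y + t S` lies in a slice. -/
theorem aux_point {X Y : Type*} [NormedAddCommGroup X] [NormedSpace ℝ X]
    [NormedAddCommGroup Y] [NormedSpace ℝ Y] (y : Y) (δ ε t : ℝ) (g : StrongDual ℝ Y)
    (hy : ‖y‖ = 1) (hε : 0 < ε) (hε1 : ε ≤ 1) (ht : 0 < t) (htδ : 2 * t < δ) (ht6 : 6 * t ≤ 1)
    (hg : ∀ h : Y, ‖h‖ < δ → ‖y + h‖ ≤ 1 + g h + ε * ‖h‖)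
    (f : StrongDual ℝ X) (hf : ‖f‖ = 1) (S : X →L[ℝ] Y) (hS : ‖S‖ ≤ 1) :
    ∃ x : X, ‖x‖ ≤ 1 ∧ 1 - 3 * t ≤ f x ∧
      ‖rankOneOp f y + t • S‖ ≤ 1 + t * g (S x) + 2 * ε * t := by
  have hz : ‖rankOneOp f y‖ = 1 := by
    unfold rankOneOp
    rw [ContinuousLinearMap.norm_smulRight_apply, hf, hy, one_mul]
  set N := rankOneOp f y + t • S with hN
  have hNlow : 1 - t ≤ ‖N‖ := by
    have h1 : ‖rankOneOp f y‖ ≤ ‖N‖ + ‖t • S‖ := by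
      have := norm_sub_le N (t • S)
      rwa [hN, add_sub_cancel_right, ← hN] at this
    rw [norm_smul, Real.norm_of_nonneg ht.le, hz] at h1
    nlinarith
  have hεt : 0 < ε * t := mul_pos hε ht
  obtain ⟨x, hx, hxf, hxN⟩ : ∃ x : X, ‖x‖ ≤ 1 ∧ 0 ≤ f x ∧ ‖N‖ - ε * t < ‖N x‖ := by
    obtain ⟨x, hx, hxN⟩ := N.exists_lt_apply_of_lt_opNorm (r := ‖N‖ - ε * t) (by linarith)
    rcases le_total 0 (f x) with h | h
    · exact ⟨x, hx.le, h, hxN⟩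
    · exact ⟨-x, by simpa using hx.le, by simpa using h, by simpa using hxN⟩
  have hNx : N x = f x • y + t • S x := by
    simp [hN, rankOneOp]
  have hSx : ‖S x‖ ≤ 1 := by
    have := S.le_opNorm x
    nlinarith [norm_nonneg x, norm_nonneg S]
  have hfx1 : f x ≤ 1 := by
    have h1 := f.le_opNorm x
    have h2 := le_abs_self (f x)
    rw [Real.norm_eq_abs, hf] at h1
    linarith
  have hup : ‖N x‖ ≤ f x + t := by
    rw [hNx]
    refine (norm_add_le _ _).trans ?_
    rw [norm_smul, norm_smul, Real.norm_of_nonneg hxf, Real.norm_of_nonneg ht.le, hy]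
    nlinarith
  have hεt1 : ε * t ≤ t := by nlinarith
  have hlow : 1 - 3 * t ≤ f x := by linarith
  refine ⟨x, hx, hlow, ?_⟩
  have ha : 0 < f x := by linarith
  have hsc : N x = f x • (y + (t / f x) • S x) := by
    rw [hNx, smul_add, smul_smul, mul_div_cancel₀ _ ha.ne']
  have hn : ‖(t / f x) • S x‖ ≤ t / f x := by
    rw [norm_smul, Real.norm_of_nonneg (by positivity)]
    exact mul_le_of_le_one_right (by positivity) hSx
  have hta : t / f x ≤ 2 * t := by
    rw [div_le_iff₀ ha]
    nlinarith
  have h1 := hg _ (lt_of_le_of_lt (hn.trans hta) htδ)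
  have h2 : ‖N x‖ ≤ f x * (1 + g ((t / f x) • S x) + ε * (t / f x)) := by
    rw [hsc, norm_smul, Real.norm_of_nonneg ha.le]
    refine mul_le_mul_of_nonneg_left ?_ ha.le
    nlinarith
  have h3 : f x * (1 + g ((t / f x) • S x) + ε * (t / f x)) = f x + t * g (S x) + ε * t := by
    rw [map_smul, smul_eq_mul]
    field_simp
  linarith

/-- Corollary 2.12: if the norm of `Y` is non-rough, `X` has the BSCSP and `H` is
a closed subspace of `L(X, Y)` with `X* ⊗ Y ⊆ H`, then `H*` has the `w*`-BSCSP. -/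
theorem statement8 {X Y : Type*} [NormedAddCommGroup X] [NormedSpace ℝ X] [CompleteSpace X]
    [NormedAddCommGroup Y] [NormedSpace ℝ Y] [CompleteSpace Y]
    (hY : NonRoughNorm Y) (hX : BallSCSProperty X)
    (H : Submodule ℝ (X →L[ℝ] Y)) (hH : IsClosed (H : Set (X →L[ℝ] Y)))
    (hmem : ∀ (f : StrongDual ℝ X) (y : Y), rankOneOp f y ∈ H) :
    WStarBallSCSProperty H := by
  intro ε₀ hε₀
  obtain ⟨ε, hε, hε1, hεε⟩ : ∃ ε : ℝ, 0 < ε ∧ ε ≤ 1 ∧ 8 * ε ≤ ε₀ :=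
    ⟨min (ε₀ / 8) 1, by positivity, min_le_right _ _, by
      have := min_le_left (ε₀ / 8) 1
      linarith⟩
  obtain ⟨y, δ, g, hy, hδ, hgn, hg⟩ := aux_smooth hY ε hε
  obtain ⟨n, lam, f, α, hlam, hsum, hf, hα, hdiam⟩ := hX ε hε
  obtain ⟨a, ha, haα⟩ : ∃ a : ℝ, 0 < a ∧ ∀ i, a ≤ α i := by
    obtain ⟨i, hi⟩ := Finite.exists_min α
    exact ⟨α i, (hα i).1, hi⟩
  obtain ⟨t, ht, htδ, ht6, hta⟩ : ∃ t : ℝ, 0 < t ∧ 2 * t < δ ∧ 6 * t ≤ 1 ∧ 3 * t < a := by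
    refine ⟨min (δ / 4) (min (1 / 6) (a / 6)), by positivity, ?_, ?_, ?_⟩
    · have := min_le_left (δ / 4) (min (1 / 6) (a / 6))
      linarith
    · have := (min_le_right (δ / 4) (min (1 / 6) (a / 6))).trans (min_le_left _ _)
      linarith
    · have := (min_le_right (δ / 4) (min (1 / 6) (a / 6))).trans (min_le_right _ _)
      linarith
  have hεt : 0 < ε * t := mul_pos hε ht
  refine ⟨n, lam, fun i => ⟨rankOneOp (f i) y, hmem _ _⟩, fun _ => ε * t, hlam, hsum, ?_, ?_, ?_⟩
  · intro i
    change ‖rankOneOp (f i) y‖ = 1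
    unfold rankOneOp
    rw [ContinuousLinearMap.norm_smulRight_apply, hf, hy, one_mul]
  · intro i
    exact ⟨hεt, by nlinarith⟩
  -- the combination of slices in `X` is bounded
  have hbd : ∀ u v : Fin (n + 1) → X, (∀ i, ‖u i‖ ≤ 1 ∧ 1 - α i < f i (u i)) →
      (∀ i, ‖v i‖ ≤ 1 ∧ 1 - α i < f i (v i)) →
      ‖∑ i, lam i • u i - ∑ i, lam i • v i‖ ≤ ε := by
    intro u v hu hv
    rw [← dist_eq_norm]
    refine le_trans (Metric.dist_le_diam_of_mem (s := {z : X | ∃ g : Fin (n + 1) → X,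
      (∀ i, ‖g i‖ ≤ 1 ∧ 1 - α i < f i (g i)) ∧ z = ∑ i, lam i • g i}) ?_
      ⟨u, hu, rfl⟩ ⟨v, hv, rfl⟩) hdiam.le
    refine (Metric.isBounded_closedBall (x := (0 : X)) (r := 1)).subset ?_
    rintro z ⟨w, hw, rfl⟩
    rw [mem_closedBall_zero_iff]
    refine (norm_sum_le _ _).trans ?_
    rw [← hsum]
    refine Finset.sum_le_sum fun i _ => ?_
    rw [norm_smul, Real.norm_of_nonneg (hlam i).le]
    exact mul_le_of_le_one_right (hlam i).le (hw i).1
  have key : ∀ p q : Fin (n + 1) → StrongDual ℝ H,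
      (∀ i, ‖p i‖ ≤ 1 ∧ 1 - ε * t < p i ⟨rankOneOp (f i) y, hmem _ _⟩) →
      (∀ i, ‖q i‖ ≤ 1 ∧ 1 - ε * t < q i ⟨rankOneOp (f i) y, hmem _ _⟩) →
      ∀ T : H, ‖T‖ = 1 → ∑ i, lam i * (p i T - q i T) ≤ 7 * ε := by
    intro p q hp hq T hT
    have hT1 : ‖(T : X →L[ℝ] Y)‖ ≤ 1 := le_of_eq hT
    have hT2 : ‖(-T : X →L[ℝ] Y)‖ ≤ 1 := by rw [norm_neg]; exact hT1
    choose u hu1 hu2 hu3 using fun i => aux_point y δ ε t g hy hε hε1 ht htδ ht6 hg (f i) (hf i)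
      (T : X →L[ℝ] Y) hT1
    choose v hv1 hv2 hv3 using fun i => aux_point y δ ε t g hy hε hε1 ht htδ ht6 hg (f i) (hf i)
      (-T : X →L[ℝ] Y) hT2
    have hle : ∀ (r : StrongDual ℝ H) (S : H), ‖r‖ ≤ 1 → r S ≤ ‖(S : X →L[ℝ] Y)‖ := by
      intro r S hr
      have h1 := r.le_opNorm S
      have h2 := le_abs_self (r S)
      rw [Real.norm_eq_abs] at h1
      have h3 : ‖r‖ * ‖S‖ ≤ ‖S‖ := mul_le_of_le_one_left (norm_nonneg _) hr
      exact h2.trans (h1.trans h3)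
    have hi : ∀ i, t * (p i T - q i T) ≤
        t * (g ((T : X →L[ℝ] Y) (u i)) - g ((T : X →L[ℝ] Y) (v i))) + 6 * (ε * t) := by
      intro i
      have h1 := hle (p i) (⟨rankOneOp (f i) y, hmem _ _⟩ + t • T) (hp i).1
      have h2 := hle (q i) (⟨rankOneOp (f i) y, hmem _ _⟩ + t • (-T)) (hq i).1
      have h3 := (hp i).2
      have h4 := (hq i).2
      have h5 := h1.trans (hu3 i)
      have h6 := h2.trans (hv3 i)
      rw [map_add, map_smul, smul_eq_mul] at h5 h6
      rw [map_neg] at h6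
      rw [neg_apply, map_neg] at h6
      linarith
    have hsm : ∑ i, lam i * (t * (p i T - q i T)) ≤
        ∑ i, lam i * (t * (g ((T : X →L[ℝ] Y) (u i)) - g ((T : X →L[ℝ] Y) (v i)))
          + 6 * (ε * t)) :=
      Finset.sum_le_sum fun i _ => mul_le_mul_of_nonneg_left (hi i) (hlam i).le
    have hL : ∑ i, lam i * (t * (p i T - q i T)) = t * ∑ i, lam i * (p i T - q i T) := by
      rw [Finset.mul_sum]
      exact Finset.sum_congr rfl fun i _ => by ring
    have hR : ∑ i, lam i * (t * (g ((T : X →L[ℝ] Y) (u i)) - g ((T : X →L[ℝ] Y) (v i)))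
          + 6 * (ε * t)) =
        t * g ((T : X →L[ℝ] Y) (∑ i, lam i • u i - ∑ i, lam i • v i)) + 6 * (ε * t) := by
      simp only [mul_add, Finset.sum_add_distrib]
      rw [← Finset.sum_mul, hsum, one_mul]
      congr 1
      simp only [map_sub, map_sum, map_smul, smul_eq_mul]
      rw [← Finset.sum_sub_distrib, Finset.mul_sum]
      exact Finset.sum_congr rfl fun i _ => by ring
    rw [hL, hR] at hsm
    have hd := hbd u v (fun i => ⟨hu1 i, by linarith [hu2 i, haα i]⟩)
      (fun i => ⟨hv1 i, by linarith [hv2 i, haα i]⟩)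
    have hgT : g ((T : X →L[ℝ] Y) (∑ i, lam i • u i - ∑ i, lam i • v i)) ≤ ε := by
      refine (le_abs_self _).trans ?_
      rw [← Real.norm_eq_abs]
      refine (g.le_opNorm _).trans ?_
      rw [hgn, one_mul]
      refine ((T : X →L[ℝ] Y).le_opNorm _).trans ?_
      exact (mul_le_of_le_one_left (norm_nonneg _) hT1).trans hd
    have : t * ∑ i, lam i * (p i T - q i T) ≤ t * (7 * ε) := by nlinarith
    exact le_of_mul_le_mul_left this ht
  refine lt_of_le_of_lt (Metric.diam_le_of_forall_dist_le (C := 7 * ε) (by positivity) ?_)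
    (by linarith)
  rintro φ ⟨p, hp, rfl⟩ ψ ⟨q, hq, rfl⟩
  rw [dist_eq_norm]
  refine ContinuousLinearMap.opNorm_le_of_unit_norm (by positivity) fun T hT => ?_
  have e1 : (∑ i, lam i • p i - ∑ i, lam i • q i) T = ∑ i, lam i * (p i T - q i T) := by
    simp [mul_sub, Finset.sum_sub_distrib]
  have e2 : ∑ i, lam i * (q i T - p i T) = - ∑ i, lam i * (p i T - q i T) := by
    rw [← Finset.sum_neg_distrib]
    exact Finset.sum_congr rfl fun i _ => by ring
  rw [e1, Real.norm_eq_abs, abs_le]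
  have k1 := key p q hp hq T hT
  have k2 := key q p hq hp T hT
  exact ⟨by linarith, k1⟩
end

section
/- Let X and Y be real Banach spaces and let H be a closed subspace of L(X*,Y) such that the rank-one operator x ⊗ y (given by x* ↦ x*(x)·y) belongs to H for every x ∈ X and y ∈ Y. If X* has the w*-Ball Dentable Property and Y* has the w*-Ball Small Combination of Slices Property, then H* has the w*-Ball Small Combination of Slices Property. -/
set_option synthInstance.maxHeartbeats 1000000
set_option maxHeartbeats 1000000
set_option maxSynthPendingDepth 3

open Metric Set Filter

/-- Key estimate: a functional in a small slice determined by `x ⊗ y` is close to `f₀ ⊗ g`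
where `g y = φ (x ⊗ y)`. -/
lemma key_est {X Y : Type*} [NormedAddCommGroup X] [NormedSpace ℝ X]
    [NormedAddCommGroup Y] [NormedSpace ℝ Y]
    (x : X) (f₀ : StrongDual ℝ X) (hf₀ : ‖f₀‖ ≤ 1) (hf₀x : f₀ x = 1)
    (α ε : ℝ) (hα : 0 < α) (hε : 0 < ε)
    (hclose : ∀ f : StrongDual ℝ X, ‖f‖ ≤ 1 → 1 - α < f x → ‖f - f₀‖ ≤ ε)
    (hx : ‖x‖ = 1) (y : Y) (hy : ‖y‖ = 1) (T : StrongDual ℝ X →L[ℝ] Y) (hT : ‖T‖ ≤ 1) :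
    ‖injTensorElem x y + (α / 2) • (T - injTensorElem x (T f₀))‖ ≤ 1 + (α / 2) * (2 * ε) := by
  have hTb : ∀ u : StrongDual ℝ X, ‖T u‖ ≤ ‖u‖ := fun u =>
    (T.le_opNorm u).trans (by nlinarith [norm_nonneg u])
  -- pointwise bound
  have hpt : ∀ f : StrongDual ℝ X, ‖f‖ ≤ 1 →
      ‖f x • y + (α / 2) • (T f - f x • T f₀)‖ ≤ |f x| + (α / 2) * ‖f - f x • f₀‖ := by
    intro f hf
    refine (norm_add_le _ _).trans ?_
    rw [norm_smul, norm_smul, hy, Real.norm_eq_abs, Real.norm_of_nonneg (by positivity), mul_one]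
    have : T f - f x • T f₀ = T (f - f x • f₀) := by simp
    rw [this]
    gcongr
    exact hTb _
  have habs : ∀ f : StrongDual ℝ X, ‖f‖ ≤ 1 → |f x| ≤ 1 := by
    intro f hf
    have := f.le_opNorm x
    rw [hx, mul_one, Real.norm_eq_abs] at this
    linarith
  have hpos : ∀ f : StrongDual ℝ X, ‖f‖ ≤ 1 → 1 - α < f x → ‖f - f x • f₀‖ ≤ 2 * ε := by
    intro f hf hfx
    have h1 := hclose f hf hfx
    have h2 : ‖(f - f₀) x‖ ≤ ‖f - f₀‖ := by
      have := (f - f₀).le_opNorm x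
      rwa [hx, mul_one] at this
    have e : f - f x • f₀ = (f - f₀) - (f - f₀) x • f₀ := by
      ext u; simp [hf₀x]; ring
    rw [e]
    refine (norm_sub_le _ _).trans ?_
    rw [norm_smul]
    nlinarith [norm_nonneg ((f - f₀) x), norm_nonneg f₀]
  refine ContinuousLinearMap.opNorm_le_of_unit_norm (by positivity) ?_
  intro f hf
  have hf := hf.le
  have ee : (injTensorElem x y + (α / 2) • (T - injTensorElem x (T f₀))) f
      = f x • y + (α / 2) • (T f - f x • T f₀) := by
    simp [injTensorElem]
  rw [ee]
  refine (hpt f hf).trans ?_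
  have ha := habs f hf
  rcases lt_or_ge (1 - α) (f x) with h | h
  · have := hpos f hf h
    gcongr
  · rcases lt_or_ge (1 - α) (-f x) with h' | h'
    · have := hpos (-f) (by simpa using hf) (by simpa using h')
      have e : ‖-f - (-f) x • f₀‖ = ‖f - f x • f₀‖ := by
        rw [← norm_neg]; congr 1; ext u; simp; ring
      rw [e] at this
      gcongr
    · have h3 : |f x| ≤ 1 - α := abs_le.2 ⟨by linarith, h⟩
      have h4 : ‖f - f x • f₀‖ ≤ 2 := by
        refine (norm_sub_le _ _).trans ?_
        rw [norm_smul, Real.norm_eq_abs]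
        nlinarith [abs_nonneg (f x), norm_nonneg f₀]
      nlinarith

/-- Proposition 2.14: if `H` is a closed subspace of `L(X*, Y)` with
`X ⊗ Y ⊆ H`, `X*` has the `w*`-BDP and `Y*` has the `w*`-BSCSP, then `H*` has the
`w*`-BSCSP. -/
theorem statement10 {X Y : Type*} [NormedAddCommGroup X] [NormedSpace ℝ X] [CompleteSpace X]
    [NormedAddCommGroup Y] [NormedSpace ℝ Y] [CompleteSpace Y]
    (H : Submodule ℝ (StrongDual ℝ X →L[ℝ] Y))
    (hH : IsClosed (H : Set (StrongDual ℝ X →L[ℝ] Y)))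
    (hmem : ∀ (x : X) (y : Y), injTensorElem x y ∈ H)
    (hX : WStarBallDentableProperty X) (hY : WStarBallSCSProperty Y) :
    WStarBallSCSProperty H := by
  intro ε₀ hε₀
  obtain ⟨ε, hε, hεε⟩ : ∃ ε : ℝ, 0 < ε ∧ 8 * ε < ε₀ := ⟨ε₀ / 9, by positivity, by linarith⟩
  obtain ⟨x, α, hx, hα, hα1, hdX⟩ := hX ε hε
  obtain ⟨n, lam, y, a, hlam, hsum, hy, ha, hdY⟩ := hY ε hε
  have hx0 : ‖x‖ ≠ 0 := by rw [hx]; exact one_ne_zero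
  obtain ⟨f₀, hf₀, hf₀x⟩ := exists_dual_vector ℝ x hx0
  have hf₀x : f₀ x = 1 := by rw [hf₀x, hx]; simp
  have hclose : ∀ f : StrongDual ℝ X, ‖f‖ ≤ 1 → 1 - α < f x → ‖f - f₀‖ ≤ ε := by
    intro f hf hfx
    rw [← dist_eq_norm]
    have m1 : f ∈ {f : StrongDual ℝ X | ‖f‖ ≤ 1 ∧ 1 - α < f x} := ⟨hf, hfx⟩
    have m2 : f₀ ∈ {f : StrongDual ℝ X | ‖f‖ ≤ 1 ∧ 1 - α < f x} := ⟨hf₀.le, by linarith⟩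
    refine (Metric.dist_le_diam_of_mem ?_ m1 m2).trans hdX.le
    exact (Metric.isBounded_closedBall (x := (0 : StrongDual ℝ X)) (r := 1)).subset
      fun f hf => by simpa using hf.1
  have hnorm : ∀ v : Y, ‖injTensorElem x v‖ = ‖v‖ := by
    intro v
    apply le_antisymm
    · refine ContinuousLinearMap.opNorm_le_bound _ (norm_nonneg _) fun f => ?_
      have : injTensorElem x v f = f x • v := by simp [injTensorElem]
      rw [this, norm_smul, mul_comm]
      have := f.le_opNorm x
      rw [hx, mul_one] at this
      gcongr
    · have := (injTensorElem x v).le_opNorm f₀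
      have e : injTensorElem x v f₀ = v := by simp [injTensorElem, hf₀x]
      rwa [e, hf₀, mul_one] at this
  -- the map v ↦ x ⊗ v into H
  let J : Y →L[ℝ] H := LinearMap.mkContinuous
    { toFun := fun v => (⟨injTensorElem x v, hmem x v⟩ : H)
      map_add' := by intro u v; ext f; simp [injTensorElem]
      map_smul' := by
        intro c v; ext f; exact smul_comm (f x) c v } 1
    (by intro v; rw [one_mul]; exact (hnorm v).le)
  have hJ : ∀ v, (J v : StrongDual ℝ X →L[ℝ] Y) = injTensorElem x v := fun v => rfl
  have hJn : ∀ v, ‖J v‖ = ‖v‖ := fun v => hnorm v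
  let β : Fin (n + 1) → ℝ := fun i => min (a i) (α / 2 * ε)
  have hβ : ∀ i, 0 < β i := fun i => lt_min (ha i).1 (by positivity)
  -- evaluation at f₀
  have hkey : ∀ i (φ : StrongDual ℝ H), ‖φ‖ ≤ 1 → 1 - β i < φ (J (y i)) →
      ∀ T : H, ‖T‖ ≤ 1 → φ T - φ (J ((T : StrongDual ℝ X →L[ℝ] Y) f₀)) ≤ 3 * ε := by
    intro i φ hφ hφi T hT
    have h1 := key_est x f₀ hf₀.le hf₀x α ε hα hε hclose hx (y i) (hy i) T hT
    have h2 : ‖J (y i) + (α / 2) • (T - J ((T : StrongDual ℝ X →L[ℝ] Y) f₀))‖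
        ≤ 1 + (α / 2) * (2 * ε) := h1
    have h3 := (le_abs_self _).trans
      (φ.le_opNorm (J (y i) + (α / 2) • (T - J ((T : StrongDual ℝ X →L[ℝ] Y) f₀))))
    rw [map_add, map_smul, map_sub, smul_eq_mul] at h3
    have h4 : β i ≤ α / 2 * ε := min_le_right _ _
    have h5 : α / 2 * (φ T - φ (J ((T : StrongDual ℝ X →L[ℝ] Y) f₀))) ≤ α / 2 * (3 * ε) := by
      nlinarith [norm_nonneg (J (y i) + (α / 2) • (T - J ((T : StrongDual ℝ X →L[ℝ] Y) f₀)))]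
    exact le_of_mul_le_mul_left h5 (by positivity)
  refine ⟨n, lam, fun i => J (y i), β, hlam, hsum, fun i => by rw [hJn, hy], fun i =>
    ⟨hβ i, (min_le_left _ _).trans_lt (ha i).2⟩, ?_⟩
  refine lt_of_le_of_lt (Metric.diam_le_of_forall_dist_le (C := 8 * ε) (by positivity) ?_) hεε
  rintro _ ⟨g, hg, rfl⟩ _ ⟨g', hg', rfl⟩
  have hmemY : ∀ g : Fin (n + 1) → StrongDual ℝ H, (∀ i, ‖g i‖ ≤ 1 ∧ 1 - β i < g i (J (y i))) →
      (∑ i, lam i • (g i).comp J) ∈ {φ : StrongDual ℝ Y | ∃ g : Fin (n + 1) → StrongDual ℝ Y,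
      (∀ i, ‖g i‖ ≤ 1 ∧ 1 - a i < g i (y i)) ∧ φ = ∑ i, lam i • g i} := by
    intro g hg
    refine ⟨fun i => (g i).comp J, fun i => ⟨?_, ?_⟩, rfl⟩
    · refine ContinuousLinearMap.opNorm_le_bound _ zero_le_one fun v => ?_
      refine ((g i).le_opNorm (J v)).trans ?_
      rw [hJn]
      exact mul_le_mul_of_nonneg_right (hg i).1 (norm_nonneg _)
    · have : β i ≤ a i := min_le_left _ _
      have := (hg i).2
      show 1 - a i < g i (J (y i))
      linarith
  have hd : ‖(∑ i, lam i • (g i).comp J) - ∑ i, lam i • (g' i).comp J‖ ≤ ε := by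
    rw [← dist_eq_norm]
    refine (Metric.dist_le_diam_of_mem ?_ (hmemY g hg) (hmemY g' hg')).trans hdY.le
    refine (Metric.isBounded_closedBall (x := (0 : StrongDual ℝ Y)) (r := 1)).subset ?_
    rintro _ ⟨k, hk, rfl⟩
    rw [mem_closedBall_zero_iff]
    refine (norm_sum_le _ _).trans ?_
    rw [← hsum]
    refine Finset.sum_le_sum fun i _ => ?_
    rw [norm_smul, Real.norm_of_nonneg (hlam i).le]
    nlinarith [(hk i).1, hlam i]
  have hcomb : ∀ g : Fin (n + 1) → StrongDual ℝ H, (∀ i, ‖g i‖ ≤ 1 ∧ 1 - β i < g i (J (y i))) →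
      ∀ T : H, ‖T‖ ≤ 1 → (∑ i, lam i • g i) T
        - (∑ i, lam i • (g i).comp J) ((T : StrongDual ℝ X →L[ℝ] Y) f₀) ≤ 3 * ε := by
    intro g hg T hT
    have e : (∑ i, lam i • g i) T
        - (∑ i, lam i • (g i).comp J) ((T : StrongDual ℝ X →L[ℝ] Y) f₀)
        = ∑ i, lam i * (g i T - g i (J ((T : StrongDual ℝ X →L[ℝ] Y) f₀))) := by
      simp [mul_sub, Finset.sum_sub_distrib]
    rw [e]
    calc _ ≤ ∑ i, lam i * (3 * ε) := Finset.sum_le_sum fun i _ =>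
          mul_le_mul_of_nonneg_left (hkey i (g i) (hg i).1 (hg i).2 T hT) (hlam i).le
      _ = 3 * ε := by rw [← Finset.sum_mul, hsum, one_mul]
  rw [dist_eq_norm]
  have hone : ∀ T : H, ‖T‖ ≤ 1 →
      ((∑ i, lam i • g i) - ∑ i, lam i • g' i) T ≤ 7 * ε := by
    intro T hT
    have h1 := hcomb g hg T hT
    have h2 := hcomb g' hg' (-T) (by rwa [norm_neg])
    have h3 := (le_abs_self _).trans
      (((∑ i, lam i • (g i).comp J) - ∑ i, lam i • (g' i).comp J).le_opNorm
        ((T : StrongDual ℝ X →L[ℝ] Y) f₀))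
    have h4 : ‖(T : StrongDual ℝ X →L[ℝ] Y) f₀‖ ≤ 1 := by
      have := (T : StrongDual ℝ X →L[ℝ] Y).le_opNorm f₀
      rw [hf₀, mul_one] at this
      exact this.trans hT
    rw [sub_apply] at h3 ⊢
    have e2 : ((-T : H) : StrongDual ℝ X →L[ℝ] Y) f₀ = -((T : StrongDual ℝ X →L[ℝ] Y) f₀) := by
      simp
    rw [e2, map_neg, map_neg] at h2
    have h5 := mul_le_mul hd h4 (norm_nonneg _) hε.le
    linarith
  refine ContinuousLinearMap.opNorm_le_of_unit_norm (by positivity) fun T hT => ?_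
  rw [Real.norm_eq_abs, abs_le]
  have h1 := hone T hT.le
  have h2 := hone (-T) (by rw [norm_neg]; exact hT.le)
  rw [map_neg] at h2
  constructor <;> linarith
end

section
/- Let X and Y be real Banach spaces such that there exists f ∈ S_{Y**} with n(Y**, f) = 1, and let H be a closed subspace of L(X,Y) such that the rank-one operator x* ⊗ y belongs to H for every x* ∈ X* and y ∈ Y. If H* has the w*-Ball Small Combination of Slices Property, then X has the Ball Small Combination of Slices Property. -/
set_option synthInstance.maxHeartbeats 1000000
set_option maxHeartbeats 1000000
set_option maxSynthPendingDepth 3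

open Metric Set Filter

/-- Functionals almost maximal at `f` are almost norming for operators into `Y`. -/
theorem exists_functional_aux {X Y : Type*} [NormedAddCommGroup X] [NormedSpace ℝ X]
    [NormedAddCommGroup Y] [NormedSpace ℝ Y]
    (f : StrongDual ℝ (StrongDual ℝ Y)) (hf : ‖f‖ = 1)
    (hnf : nConstant (StrongDual ℝ (StrongDual ℝ Y)) f = 1)
    (T : X →L[ℝ] Y) (hT : ‖T‖ = 1) (α δ : ℝ) (hα : 0 < α) (hα1 : α < 1) (hδ : 0 < δ) :
    ∃ g : StrongDual ℝ Y, ‖g‖ ≤ 1 ∧ 1 - δ < f g ∧ 1 - α < ‖g.comp T‖ := by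
  obtain ⟨x, hx, hTx⟩ := T.exists_lt_apply_of_lt_opNorm (show 1 - α / 3 < ‖T‖ by linarith)
  have hk : ∃ k ∈ {k : ℝ | 0 ≤ k ∧ ∀ z : StrongDual ℝ (StrongDual ℝ Y),
      k * ‖z‖ ≤ ⨆ h : dualFace _ f, |h.1 z|}, 1 - α / 3 < k := by
    apply exists_lt_of_lt_csSup
    · by_contra hne
      rw [Set.not_nonempty_iff_eq_empty] at hne
      unfold nConstant at hnf
      rw [hne, Real.sSup_empty] at hnf
      norm_num at hnf
    · have : (1 : ℝ) - α / 3 < nConstant (StrongDual ℝ (StrongDual ℝ Y)) f := by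
        rw [hnf]; linarith
      exact this
  obtain ⟨k, ⟨hk0, hk⟩, hk1⟩ := hk
  set z := NormedSpace.inclusionInDoubleDual ℝ Y (T x) with hz
  have hzn : ‖z‖ = ‖T x‖ := (NormedSpace.inclusionInDoubleDualLi ℝ (E := Y)).norm_map (T x)
  have hTx1 : ‖T x‖ ≤ 1 := by
    have := T.le_opNorm x
    rw [hT] at this; linarith
  have hkz := hk z
  have hlt : 1 - 2 * (α / 3) < ⨆ h : dualFace _ f, |h.1 z| := by
    rw [hzn] at hkz
    nlinarith
  have hne : Nonempty (dualFace _ f) := by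
    by_contra hne
    rw [not_nonempty_iff] at hne
    rw [Real.iSup_of_isEmpty] at hlt
    linarith
  obtain ⟨⟨h, hh1, hhf⟩, hhz⟩ := exists_lt_of_lt_ciSup hlt
  simp only at hhz
  obtain ⟨x', hx', hhz', hTx'⟩ : ∃ x' : X, ‖x'‖ < 1 ∧
      1 - 2 * (α / 3) < h (NormedSpace.inclusionInDoubleDual ℝ Y (T x')) ∧ ‖T x'‖ ≤ 1 := by
    rcases lt_abs.1 hhz with h1 | h1
    · exact ⟨x, hx, h1, hTx1⟩
    · refine ⟨-x, by simpa using hx, ?_, by simpa using hTx1⟩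
      rw [map_neg, map_neg, map_neg]
      exact h1
  set t := min (min (α / 3) (δ / 3)) 1 with ht
  have ht0 : 0 < t := by positivity
  have ht1 : t ≤ 1 := min_le_right _ _
  have htα : t ≤ α / 3 := (min_le_left _ _).trans (min_le_left _ _)
  have htδ : t ≤ δ / 3 := (min_le_left _ _).trans (min_le_right _ _)
  set w := NormedSpace.inclusionInDoubleDual ℝ Y (T x') with hw
  set F := f + t • w with hF
  have hFn : 1 + t * h w - t * t < ‖F‖ := by
    have h1 : h F = 1 + t * h w := by rw [hF, map_add, map_smul, hhf, smul_eq_mul]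
    have h2 : h F ≤ ‖F‖ := by
      have := (le_abs_self _).trans (h.le_of_opNorm_le hh1 F)
      linarith
    nlinarith
  obtain ⟨g0, hg0, hg0F⟩ := F.exists_lt_apply_of_lt_opNorm hFn
  obtain ⟨g, hg, hgF⟩ : ∃ g : StrongDual ℝ Y, ‖g‖ < 1 ∧ 1 + t * h w - t * t < F g := by
    rw [Real.norm_eq_abs] at hg0F
    rcases lt_abs.1 hg0F with h1 | h1
    · exact ⟨g0, hg0, h1⟩
    · exact ⟨-g0, by simpa using hg0, by rw [map_neg]; exact h1⟩
  have hFg : F g = f g + t * g (T x') := by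
    simp [hF, hw]
  have hfg : f g ≤ 1 := by
    have := (le_abs_self _).trans (f.le_opNorm g)
    rw [hf] at this; linarith
  have hgT : g (T x') ≤ 1 := by
    have := (le_abs_self _).trans (g.le_opNorm (T x'))
    nlinarith [norm_nonneg g, norm_nonneg (T x')]
  refine ⟨g, hg.le, ?_, ?_⟩
  · nlinarith
  · have h3 : h w - t < g (T x') := by
      rw [hFg] at hgF
      by_contra hcon
      push Not at hcon
      nlinarith
    have h4 : g (T x') ≤ ‖g.comp T‖ := by
      have h5 := (le_abs_self _).trans ((g.comp T).le_opNorm x')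
      have h6 : (g.comp T) x' = g (T x') := rfl
      rw [h6] at h5
      nlinarith [norm_nonneg (g.comp T)]
    linarith

/-- Proposition 2.17: if there is `f ∈ S_{Y**}` with `n(Y**, f) = 1` and `H` is a
closed subspace of `L(X, Y)` with `X* ⊗ Y ⊆ H` whose dual `H*` has the `w*`-BSCSP, then `X`
has the BSCSP. -/
theorem statement12 {X Y : Type*} [NormedAddCommGroup X] [NormedSpace ℝ X] [CompleteSpace X]
    [NormedAddCommGroup Y] [NormedSpace ℝ Y] [CompleteSpace Y]
    (f : StrongDual ℝ (StrongDual ℝ Y)) (hf : ‖f‖ = 1)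
    (hnf : nConstant (StrongDual ℝ (StrongDual ℝ Y)) f = 1)
    (H : Submodule ℝ (X →L[ℝ] Y)) (hH : IsClosed (H : Set (X →L[ℝ] Y)))
    (hmem : ∀ (g : StrongDual ℝ X) (y : Y), rankOneOp g y ∈ H)
    (hHs : WStarBallSCSProperty H) :
    BallSCSProperty X := by
  intro ε hε
  obtain ⟨n, lam, T, α, hlam, hsum, hT, hα, hdiam⟩ := hHs (ε / 4) (by positivity)
  have hex := fun i => exists_functional_aux f hf hnf (T i : X →L[ℝ] Y) (by simpa using hT i)
    (α i) (ε / 8) (hα i).1 (hα i).2 (by positivity)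
  choose g hg1 hgf hgT using hex
  have hN : ∀ i, 0 < ‖(g i).comp (T i : X →L[ℝ] Y)‖ := fun i => by
    linarith [hgT i, (hα i).2]
  refine ⟨n, lam, fun i => ‖(g i).comp (T i : X →L[ℝ] Y)‖⁻¹ • (g i).comp (T i : X →L[ℝ] Y),
    fun i => 1 - (1 - α i) / ‖(g i).comp (T i : X →L[ℝ] Y)‖, hlam, hsum, ?_, ?_, ?_⟩
  · intro i
    rw [norm_smul, norm_inv, norm_norm, inv_mul_cancel₀ (hN i).ne']
  · intro i
    have h1 : (1 - α i) / ‖(g i).comp (T i : X →L[ℝ] Y)‖ < 1 := by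
      rw [div_lt_one (hN i)]; exact hgT i
    have h2 : 0 < (1 - α i) / ‖(g i).comp (T i : X →L[ℝ] Y)‖ :=
      div_pos (by linarith [(hα i).2]) (hN i)
    constructor <;> linarith
  refine lt_of_le_of_lt (Metric.diam_le_of_forall_dist_le (C := ε / 2) (by positivity) ?_)
    (by linarith)
  have key : ∀ (u : X) (i : Fin (n + 1)), ‖u‖ ≤ 1 →
      1 - (1 - (1 - α i) / ‖(g i).comp (T i : X →L[ℝ] Y)‖) <
        (‖(g i).comp (T i : X →L[ℝ] Y)‖⁻¹ • (g i).comp (T i : X →L[ℝ] Y)) u →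
      ‖dualTensorFunctional H u (g i)‖ ≤ 1 ∧
        1 - α i < dualTensorFunctional H u (g i) (T i) := by
    intro u i hu hui
    constructor
    · refine ContinuousLinearMap.opNorm_le_bound _ zero_le_one fun S => ?_
      have e : dualTensorFunctional H u (g i) S = g i ((S : X →L[ℝ] Y) u) := rfl
      rw [e]
      have h1 := (g i).le_of_opNorm_le (hg1 i) ((S : X →L[ℝ] Y) u)
      have h2 := (S : X →L[ℝ] Y).le_opNorm u
      have h3 : ‖(S : X →L[ℝ] Y)‖ = ‖S‖ := rfl
      rw [h3] at h2
      nlinarith [norm_nonneg S]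
    · have e : dualTensorFunctional H u (g i) (T i) = ((g i).comp (T i : X →L[ℝ] Y)) u := rfl
      rw [e]
      have h4 : (‖(g i).comp (T i : X →L[ℝ] Y)‖⁻¹ • (g i).comp (T i : X →L[ℝ] Y)) u =
        ((g i).comp (T i : X →L[ℝ] Y)) u / ‖(g i).comp (T i : X →L[ℝ] Y)‖ := by
        rw [ContinuousLinearMap.smul_apply, smul_eq_mul, inv_mul_eq_div]
      rw [h4, sub_sub_cancel] at hui
      exact (div_lt_div_iff_of_pos_right (hN i)).1 hui
  rintro _ ⟨a, ha, rfl⟩ _ ⟨b, hb, rfl⟩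
  have hbdd : Bornology.IsBounded {φ : StrongDual ℝ H | ∃ g : Fin (n + 1) → StrongDual ℝ H,
      (∀ i, ‖g i‖ ≤ 1 ∧ 1 - α i < g i (T i)) ∧ φ = ∑ i, lam i • g i} := by
    refine (Metric.isBounded_closedBall (x := (0 : StrongDual ℝ H)) (r := 1)).subset ?_
    rintro _ ⟨q, hq, rfl⟩
    rw [mem_closedBall_zero_iff]
    refine (norm_sum_le _ _).trans ?_
    rw [← hsum]
    refine Finset.sum_le_sum fun i _ => ?_
    rw [norm_smul, Real.norm_of_nonneg (hlam i).le]
    nlinarith [(hq i).1, hlam i]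
  have hd := Metric.dist_le_diam_of_mem hbdd
    ⟨fun i => dualTensorFunctional H (a i) (g i),
      fun i => key (a i) i (ha i).1 (ha i).2, rfl⟩
    ⟨fun i => dualTensorFunctional H (b i) (g i),
      fun i => key (b i) i (hb i).1 (hb i).2, rfl⟩
  have hd' := hd.trans hdiam.le
  rw [dist_eq_norm] at hd'
  have hw : ‖∑ i, (lam i * f (g i)) • (a i - b i)‖ ≤ ε / 4 := by
    refine NormedSpace.norm_le_dual_bound ℝ _ (by positivity) fun p => ?_
    have e1 : p (∑ i, (lam i * f (g i)) • (a i - b i)) =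
        f (∑ i, (lam i * p (a i - b i)) • g i) := by
      simp only [map_sum, map_smul, smul_eq_mul]
      exact Finset.sum_congr rfl fun i _ => by ring
    rw [e1]
    have h1 : ‖∑ i, (lam i * p (a i - b i)) • g i‖ ≤ ε / 4 * ‖p‖ := by
      refine ContinuousLinearMap.opNorm_le_bound _ (by positivity) fun y => ?_
      have h2 := ContinuousLinearMap.le_of_opNorm_le _ hd' (⟨rankOneOp p y, hmem p y⟩ : H)
      have e2 : (∑ i, (lam i * p (a i - b i)) • g i) y =
          (∑ i, lam i • dualTensorFunctional H (a i) (g i) -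
            ∑ i, lam i • dualTensorFunctional H (b i) (g i))
              (⟨rankOneOp p y, hmem p y⟩ : H) := by
        have e3 : ∀ u i, dualTensorFunctional H u (g i) (⟨rankOneOp p y, hmem p y⟩ : H)
            = p u * g i y := by
          intro u i
          have : dualTensorFunctional H u (g i) (⟨rankOneOp p y, hmem p y⟩ : H)
            = g i (p u • y) := rfl
          rw [this, map_smul, smul_eq_mul]
        simp only [ContinuousLinearMap.sub_apply, ContinuousLinearMap.sum_apply,
          ContinuousLinearMap.smul_apply, e3, smul_eq_mul, map_sub]
        rw [← Finset.sum_sub_distrib]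
        exact Finset.sum_congr rfl fun i _ => by ring
      rw [e2]
      refine h2.trans ?_
      have h3 : ‖(⟨rankOneOp p y, hmem p y⟩ : H)‖ = ‖p‖ * ‖y‖ :=
        ContinuousLinearMap.norm_smulRight_apply p y
      rw [h3, mul_assoc]
    have h4 := f.le_opNorm (∑ i, (lam i * p (a i - b i)) • g i)
    rw [hf, one_mul] at h4
    exact h4.trans h1
  have hr : ‖∑ i, (lam i * (1 - f (g i))) • (a i - b i)‖ ≤ ε / 4 := by
    refine (norm_sum_le _ _).trans ?_
    have : ∑ i, lam i * (ε / 4) = ε / 4 := by rw [← Finset.sum_mul, hsum, one_mul]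
    rw [← this]
    refine Finset.sum_le_sum fun i _ => ?_
    have h1 : f (g i) ≤ 1 := by
      have := (le_abs_self _).trans (f.le_opNorm (g i))
      rw [hf] at this; linarith [hg1 i]
    have h2 : ‖a i - b i‖ ≤ 2 := by
      have := norm_sub_le (a i) (b i)
      linarith [(ha i).1, (hb i).1]
    rw [norm_smul, norm_mul, Real.norm_of_nonneg (hlam i).le,
      Real.norm_of_nonneg (by linarith : 0 ≤ 1 - f (g i)), mul_assoc]
    refine mul_le_mul_of_nonneg_left ?_ (hlam i).le
    nlinarith [hgf i, norm_nonneg (a i - b i)]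
  have hs : ∑ i, lam i • a i - ∑ i, lam i • b i =
      ∑ i, (lam i * f (g i)) • (a i - b i) + ∑ i, (lam i * (1 - f (g i))) • (a i - b i) := by
    rw [← Finset.sum_sub_distrib, ← Finset.sum_add_distrib]
    refine Finset.sum_congr rfl fun i _ => ?_
    rw [← add_smul, ← smul_sub]
    congr 1
    ring
  rw [dist_eq_norm, hs]
  refine (norm_add_le _ _).trans ?_
  linarith
end

section
/- Let X and Y be real Banach spaces. Assume the norm of X* is non-rough and there exists f ∈ S_{X*} with n(X*, f) = 1. Then for every closed subspace H of L(X,Y) such that the rank-one operator x* ⊗ y belongs to H for every x* ∈ X* and y ∈ Y, the following are equivalent: (i) H* has the w*-Ball Small Combination of Slices Property; (ii) Y* has the w*-Ball Small Combination of Slices Property. -/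
set_option synthInstance.maxHeartbeats 1000000
set_option maxHeartbeats 1000000
set_option maxSynthPendingDepth 3

open Metric Set Filter

theorem aux_dent {X : Type*} [NormedAddCommGroup X] [NormedSpace ℝ X]
    (hXs : NonRoughNorm (StrongDual ℝ X)) (f : StrongDual ℝ X) (hf : ‖f‖ = 1)
    (ε : ℝ) (hε : 0 < ε) :
    ∃ (u : StrongDual ℝ X) (α : ℝ) (x0 : X), ‖u‖ = 1 ∧ 0 < α ∧ α < 1 ∧ α ≤ ε ∧ ‖x0‖ ≤ 1 ∧
      ∀ x : X, ‖x‖ ≤ 1 → 1 - α < u x → ‖x - x0‖ ≤ ε := by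
  have h1 : ∃ u : StrongDual ℝ X, ‖u‖ = 1 ∧ roughness (StrongDual ℝ X) u < ε / 2 := by
    by_contra hcon
    push Not at hcon
    exact hXs ⟨ε / 2, by linarith, hcon⟩
  obtain ⟨u, hu, hr⟩ := h1
  have hb : ∀ h : StrongDual ℝ X, (‖u + h‖ + ‖u - h‖ - 2) / ‖h‖ ≤ 2 := by
    intro h
    apply div_le_of_le_mul₀ (norm_nonneg _) (by norm_num)
    have a1 := norm_add_le u h
    have a2 := norm_sub_le u h
    linarith
  have hev := Filter.eventually_lt_of_limsup_lt (f := nhdsWithin 0 {(0 : StrongDual ℝ X)}ᶜ) hr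
    ⟨2, by rw [Filter.eventually_map]; exact Filter.Eventually.of_forall hb⟩
  rw [eventually_nhdsWithin_iff, Metric.eventually_nhds_iff] at hev
  obtain ⟨r0, hr0, hev⟩ := hev
  -- choose radius and width
  set r := r0 / 2 with hrdef
  have hrpos : 0 < r := by positivity
  set α := min (ε * r / 4) (min ε (1 / 2)) with hα
  have hαpos : 0 < α := by positivity
  have hα1 : α ≤ ε * r / 4 := min_le_left _ _
  have hα2 : α ≤ ε := (min_le_right _ _).trans (min_le_left _ _)
  have hα3 : α ≤ 1 / 2 := (min_le_right _ _).trans (min_le_right _ _)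
  have hx0 : ∃ x0 : X, ‖x0‖ ≤ 1 ∧ 1 - α < u x0 := by
    have hlt : 1 - α < ‖u‖ := by rw [hu]; linarith
    obtain ⟨x, hx, hxu⟩ := u.exists_lt_apply_of_lt_opNorm hlt
    rw [Real.norm_eq_abs] at hxu
    rcases abs_cases (u x) with ⟨h, _⟩ | ⟨h, _⟩
    · exact ⟨x, hx.le, by rw [← h]; exact hxu⟩
    · exact ⟨-x, by rw [norm_neg]; exact hx.le, by rw [map_neg, ← h]; exact hxu⟩
  obtain ⟨x0, hx0n, hx0u⟩ := hx0
  refine ⟨u, α, x0, hu, hαpos, by linarith, hα2, hx0n, ?_⟩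
  intro x hx hxu
  obtain ⟨g, hg, hgx⟩ := exists_dual_vector'' ℝ (x - x0)
  by_cases hz : x - x0 = 0
  · rw [hz]; simp [hε.le]
  have hgpos : 0 < ‖g‖ := by
    rw [norm_pos_iff]; rintro rfl
    simp at hgx
    exact hz (norm_eq_zero.1 hgx.symm)
  have hh := @hev (r • g) (by
    rw [dist_zero_right, norm_smul, Real.norm_of_nonneg hrpos.le]
    nlinarith) (by
    have : r • g ≠ 0 := smul_ne_zero hrpos.ne' (norm_pos_iff.1 hgpos)
    simpa using this)
  have hng : ‖r • g‖ = r * ‖g‖ := by rw [norm_smul, Real.norm_of_nonneg hrpos.le]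
  rw [hng, div_lt_iff₀ (by positivity)] at hh
  have b1 : (u + r • g) x ≤ ‖u + r • g‖ := by
    have := (u + r • g).le_opNorm x
    have h2 := le_abs_self ((u + r • g) x)
    rw [Real.norm_eq_abs] at this
    nlinarith [norm_nonneg (u + r • g)]
  have b2 : (u - r • g) x0 ≤ ‖u - r • g‖ := by
    have := (u - r • g).le_opNorm x0
    have h2 := le_abs_self ((u - r • g) x0)
    rw [Real.norm_eq_abs] at this
    nlinarith [norm_nonneg (u - r • g)]
  simp at b1 b2 hgx
  have hrg : r * ‖g‖ ≤ r := by nlinarith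
  have key : r * ‖x - x0‖ ≤ r * ε := by
    rw [← hgx, mul_sub]
    nlinarith
  exact le_of_mul_le_mul_left key hrpos

theorem aux_close {X Y : Type*} [NormedAddCommGroup X] [NormedSpace ℝ X]
    [NormedAddCommGroup Y] [NormedSpace ℝ Y]
    (H : Submodule ℝ (X →L[ℝ] Y)) (hmem : ∀ (g : StrongDual ℝ X) (y : Y), rankOneOp g y ∈ H)
    (u : StrongDual ℝ X) (hu : ‖u‖ = 1) (α ε : ℝ) (x0 : X) (hα : 0 < α) (hα1 : α < 1)
    (hε : 0 < ε) (hx0 : ‖x0‖ ≤ 1)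
    (hd : ∀ x : X, ‖x‖ ≤ 1 → 1 - α < u x → ‖x - x0‖ ≤ ε)
    (φ : StrongDual ℝ H) (hφ : ‖φ‖ ≤ 1) (y : Y) (hy : ‖y‖ = 1) (δ : ℝ)
    (hφy : 1 - δ < φ ⟨rankOneOp u y, hmem u y⟩) (T : H) (hT : ‖T‖ ≤ 1) :
    |φ T - φ ⟨rankOneOp u (T.1 x0), hmem u _⟩| ≤ 2 * δ / α + ε + α := by
  set R : H := T - ⟨rankOneOp u (T.1 x0), hmem u _⟩ with hR
  have hRx : ∀ x, R.1 x = T.1 x - u x • T.1 x0 := by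
    intro x; simp [hR, rankOneOp]
  have hTb : ∀ x, ‖T.1 x‖ ≤ ‖x‖ := fun x => by
    have h1 := T.1.le_opNorm x
    have h2 : ‖T.1‖ ≤ 1 := hT
    nlinarith [norm_nonneg x]
  have hub : ∀ x, |u x| ≤ ‖x‖ := fun x => by
    have := u.le_opNorm x
    rw [hu, one_mul] at this; exact this
  -- near the slice
  have near : ∀ x : X, ‖x‖ ≤ 1 → 1 - α < u x → ‖R.1 x‖ ≤ ε + α := by
    intro x hx hux
    have e : R.1 x = T.1 (x - x0) + (1 - u x) • T.1 x0 := by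
      rw [hRx, map_sub, sub_smul, one_smul]; abel
    rw [e]
    refine (norm_add_le _ _).trans ?_
    have h1 := (hTb (x - x0)).trans (hd x hx hux)
    have h3 : u x ≤ 1 := (le_abs_self _).trans ((hub x).trans hx)
    rw [norm_smul, Real.norm_of_nonneg (by linarith)]
    have h2 := (hTb x0).trans hx0
    nlinarith [norm_nonneg (T.1 x0)]
  have nearabs : ∀ x : X, ‖x‖ ≤ 1 → 1 - α < |u x| → ‖R.1 x‖ ≤ ε + α := by
    intro x hx hux
    rcases abs_cases (u x) with ⟨h, _⟩ | ⟨h, _⟩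
    · exact near x hx (by rw [← h]; exact hux)
    · have := near (-x) (by rwa [norm_neg]) (by rw [map_neg, ← h]; exact hux)
      rwa [map_neg, norm_neg] at this
  have far : ∀ x : X, ‖x‖ ≤ 1 → ‖R.1 x‖ ≤ 2 := by
    intro x hx
    rw [hRx]
    refine (norm_sub_le _ _).trans ?_
    rw [norm_smul, Real.norm_eq_abs]
    have h1 := (hTb x).trans hx
    have h2 := (hTb x0).trans hx0
    have h3 := (hub x).trans hx
    nlinarith [norm_nonneg (T.1 x0), abs_nonneg (u x)]
  set U : H := ⟨rankOneOp u y, hmem u y⟩ with hU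
  have hUx : ∀ x, U.1 x = u x • y := fun x => by simp [hU, rankOneOp]
  have main : ∀ s : ℝ, |s| = α / 2 → ‖U + s • R‖ ≤ 1 + α / 2 * (ε + α) := by
    intro s hs
    change ‖(U.1 + s • R.1)‖ ≤ _
    apply ContinuousLinearMap.opNorm_le_of_unit_norm (by positivity)
    intro x hx
    have e : (U.1 + s • R.1) x = u x • y + s • R.1 x := by
      rw [← hUx]; rfl
    rw [e]
    refine (norm_add_le _ _).trans ?_
    rw [norm_smul, norm_smul, hy, Real.norm_eq_abs, Real.norm_eq_abs, hs, mul_one]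
    have h3 := (hub x).trans hx.le
    by_cases hc : 1 - α < |u x|
    · have := nearabs x hx.le hc
      nlinarith
    · have := far x hx.le
      push Not at hc
      have : 0 < α / 2 * (ε + α) := by positivity
      nlinarith
  have bd : ∀ s : ℝ, |s| = α / 2 → s * φ R ≤ δ + α / 2 * (ε + α) := by
    intro s hs
    have h1 := φ.le_opNorm (U + s • R)
    have h2 := le_abs_self (φ (U + s • R))
    rw [Real.norm_eq_abs] at h1
    have h4 : φ (U + s • R) = φ U + s * φ R := by
      rw [map_add, map_smul, smul_eq_mul]
    have h5 := main s hs
    have h6 : ‖φ‖ * ‖U + s • R‖ ≤ 1 * (1 + α / 2 * (ε + α)) :=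
      mul_le_mul hφ h5 (norm_nonneg _) zero_le_one
    linarith
  have e : φ T - φ ⟨rankOneOp u (T.1 x0), hmem u _⟩ = φ R := by rw [hR, map_sub]
  rw [e]
  have b1 := bd (α / 2) (abs_of_pos (by positivity))
  have b2 := bd (-(α / 2)) (by rw [abs_neg]; exact abs_of_pos (by positivity))
  have e2 : 2 * δ / α + ε + α = (δ + α / 2 * (ε + α)) / (α / 2) := by field_simp; ring
  rw [e2, le_div_iff₀ (by positivity)]
  rcases abs_cases (φ R) with ⟨h, _⟩ | ⟨h, _⟩ <;> rw [h] <;> nlinarith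

theorem aux_comb {Z : Type*} [NormedAddCommGroup Z] [NormedSpace ℝ Z] {n : ℕ}
    (lam : Fin n → ℝ) (hl : ∀ i, 0 < lam i) (hs : ∑ i, lam i = 1) (g k : Fin n → Z) (C : ℝ)
    (h : ∀ i, ‖g i - k i‖ ≤ C) : ‖∑ i, lam i • g i - ∑ i, lam i • k i‖ ≤ C := by
  rw [← Finset.sum_sub_distrib]
  calc _ ≤ ∑ i, ‖lam i • g i - lam i • k i‖ := norm_sum_le _ _
    _ ≤ ∑ i, lam i * C := by
        apply Finset.sum_le_sum
        intro i _
        rw [← smul_sub, norm_smul, Real.norm_of_nonneg (hl i).le]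
        exact mul_le_mul_of_nonneg_left (h i) (hl i).le
    _ = C := by rw [← Finset.sum_mul, hs, one_mul]

theorem aux_comb_le {Z : Type*} [NormedAddCommGroup Z] [NormedSpace ℝ Z] {n : ℕ}
    (lam : Fin n → ℝ) (hl : ∀ i, 0 < lam i) (hs : ∑ i, lam i = 1) (g : Fin n → Z) (C : ℝ)
    (h : ∀ i, ‖g i‖ ≤ C) : ‖∑ i, lam i • g i‖ ≤ C := by
  have := aux_comb lam hl hs g (fun _ => 0) C (by simpa using h)
  simpa using this

/-- Two elements of a combination of slices are at distance at most the diameter. -/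
theorem aux_diam {Z : Type*} [NormedAddCommGroup Z] [NormedSpace ℝ Z] {n : ℕ}
    (lam : Fin n → ℝ) (hl : ∀ i, 0 < lam i) (hs : ∑ i, lam i = 1)
    (z : Fin n → Z) (α : Fin n → ℝ) (ε : ℝ)
    (hd : Metric.diam {φ : StrongDual ℝ Z | ∃ g : Fin n → StrongDual ℝ Z,
      (∀ i, ‖g i‖ ≤ 1 ∧ 1 - α i < g i (z i)) ∧ φ = ∑ i, lam i • g i} < ε)
    (g k : Fin n → StrongDual ℝ Z) (hg : ∀ i, ‖g i‖ ≤ 1 ∧ 1 - α i < g i (z i))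
    (hk : ∀ i, ‖k i‖ ≤ 1 ∧ 1 - α i < k i (z i)) :
    ‖∑ i, lam i • g i - ∑ i, lam i • k i‖ ≤ ε := by
  rw [← dist_eq_norm]
  refine le_trans ?_ hd.le
  apply Metric.dist_le_diam_of_mem
  rotate_left
  · exact ⟨g, hg, rfl⟩
  · exact ⟨k, hk, rfl⟩
  refine Metric.isBounded_closedBall (x := (0 : StrongDual ℝ Z)) (r := 1) |>.subset ?_
  rintro _ ⟨g, hg, rfl⟩
  rw [mem_closedBall_zero_iff]
  exact aux_comb_le lam hl hs g 1 (fun i => (hg i).1)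

theorem aux_tensor_norm {X Y : Type*} [NormedAddCommGroup X] [NormedSpace ℝ X]
    [NormedAddCommGroup Y] [NormedSpace ℝ Y]
    (H : Submodule ℝ (X →L[ℝ] Y)) (x : X) (hx : ‖x‖ ≤ 1) (g : StrongDual ℝ Y) :
    ‖dualTensorFunctional H x g‖ ≤ ‖g‖ := by
  apply ContinuousLinearMap.opNorm_le_bound _ (norm_nonneg _)
  intro T
  have h1 := g.le_opNorm (T.1 x)
  have h2 := T.1.le_opNorm x
  have h3 : ‖T.1‖ = ‖T‖ := rfl
  change ‖g (T.1 x)‖ ≤ _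
  refine h1.trans (mul_le_mul_of_nonneg_left ?_ (norm_nonneg _))
  rw [h3] at h2
  nlinarith [norm_nonneg T]

theorem aux_tensor_comb {X Y : Type*} [NormedAddCommGroup X] [NormedSpace ℝ X]
    [NormedAddCommGroup Y] [NormedSpace ℝ Y]
    (H : Submodule ℝ (X →L[ℝ] Y)) (x : X) {n : ℕ} (lam : Fin n → ℝ)
    (g : Fin n → StrongDual ℝ Y) :
    ∑ i, lam i • dualTensorFunctional H x (g i)
      = dualTensorFunctional H x (∑ i, lam i • g i) := by
  ext T
  simp [dualTensorFunctional]

theorem aux_rank_norm {X Y : Type*} [NormedAddCommGroup X] [NormedSpace ℝ X]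
    [NormedAddCommGroup Y] [NormedSpace ℝ Y]
    (H : Submodule ℝ (X →L[ℝ] Y)) (hmem : ∀ (g : StrongDual ℝ X) (y : Y), rankOneOp g y ∈ H)
    (u : StrongDual ℝ X) (y : Y) : ‖(⟨rankOneOp u y, hmem u y⟩ : H)‖ = ‖u‖ * ‖y‖ := by
  change ‖rankOneOp u y‖ = _
  simp [rankOneOp, ContinuousLinearMap.norm_smulRight_apply]

/-- The embedding `y ↦ u ⊗ y` of `Y` into `H`. -/
noncomputable def auxJ {X Y : Type*} [NormedAddCommGroup X] [NormedSpace ℝ X]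
    [NormedAddCommGroup Y] [NormedSpace ℝ Y]
    (H : Submodule ℝ (X →L[ℝ] Y)) (hmem : ∀ (g : StrongDual ℝ X) (y : Y), rankOneOp g y ∈ H)
    (u : StrongDual ℝ X) : Y →L[ℝ] H :=
  LinearMap.mkContinuous
    { toFun := fun y => ⟨rankOneOp u y, hmem u y⟩
      map_add' := by intro a b; ext x; simp [rankOneOp]
      map_smul' := by intro a b; ext x; simp [rankOneOp, smul_comm a] } ‖u‖
    (fun y => (aux_rank_norm H hmem u y).le)

theorem aux_mpr {X Y : Type*} [NormedAddCommGroup X] [NormedSpace ℝ X]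
    [NormedAddCommGroup Y] [NormedSpace ℝ Y]
    (hXs : NonRoughNorm (StrongDual ℝ X))
    (f : StrongDual ℝ X) (hf : ‖f‖ = 1)
    (H : Submodule ℝ (X →L[ℝ] Y))
    (hmem : ∀ (g : StrongDual ℝ X) (y : Y), rankOneOp g y ∈ H)
    (hY : WStarBallSCSProperty Y) : WStarBallSCSProperty H := by
  intro ε hε
  set η := ε / 8 with hη
  have hηpos : 0 < η := by positivity
  obtain ⟨u, α, x0, hu, hα, hα1, hαη, hx0, hd⟩ := aux_dent hXs f hf η hηpos
  obtain ⟨n, lam, y, β, hl, hs, hy, hβ, hdiam⟩ := hY η hηpos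
  have hmin : ∀ i, 0 < min (β i) (α * η / 2) := fun i => lt_min (hβ i).1 (by positivity)
  refine ⟨n, lam, fun i => ⟨rankOneOp u (y i), hmem u (y i)⟩, fun i => min (β i) (α * η / 2),
    hl, hs, ?_, ?_, ?_⟩
  · intro i; rw [aux_rank_norm, hu, hy, one_mul]
  · intro i; exact ⟨hmin i, (min_le_left _ _).trans_lt (hβ i).2⟩
  · have key : ∀ (g : Fin (n + 1) → StrongDual ℝ H),
        (∀ i, ‖g i‖ ≤ 1 ∧ 1 - min (β i) (α * η / 2) < g i ⟨rankOneOp u (y i), hmem u (y i)⟩) →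
        ‖∑ i, lam i • g i
          - dualTensorFunctional H x0 (∑ i, lam i • (g i).comp (auxJ H hmem u))‖ ≤ 3 * η := by
      intro g hg
      rw [← aux_tensor_comb]
      apply aux_comb lam hl hs
      intro i
      apply ContinuousLinearMap.opNorm_le_of_unit_norm (by positivity)
      intro T hT
      have := aux_close H hmem u hu α η x0 hα hα1 hηpos hx0 hd (g i) (hg i).1 (y i) (hy i) _
        (hg i).2 T hT.le
      refine this.trans ?_
      have h1 : 2 * min (β i) (α * η / 2) / α ≤ η := by
        rw [div_le_iff₀ hα]
        have := min_le_right (β i) (α * η / 2)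
        linarith
      linarith
    have hin : ∀ (g : Fin (n + 1) → StrongDual ℝ H),
        (∀ i, ‖g i‖ ≤ 1 ∧ 1 - min (β i) (α * η / 2) < g i ⟨rankOneOp u (y i), hmem u (y i)⟩) →
        ∀ i, ‖(g i).comp (auxJ H hmem u)‖ ≤ 1 ∧ 1 - β i < (g i).comp (auxJ H hmem u) (y i) := by
      intro g hg i
      constructor
      · refine (ContinuousLinearMap.opNorm_comp_le _ _).trans ?_
        have h1 : ‖auxJ H hmem u‖ ≤ ‖u‖ := LinearMap.mkContinuous_norm_le _ (norm_nonneg _) _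
        rw [hu] at h1
        exact mul_le_one₀ (hg i).1 (norm_nonneg _) h1
      · have h1 := (hg i).2
        have h2 := min_le_left (β i) (α * η / 2)
        have h3 : (g i).comp (auxJ H hmem u) (y i) = g i ⟨rankOneOp u (y i), hmem u (y i)⟩ := rfl
        rw [h3]; linarith
    refine (Metric.diam_le_of_forall_dist_le (C := 7 * η) (by positivity) ?_).trans_lt
      (by linarith)
    rintro _ ⟨g, hg, rfl⟩ _ ⟨k, hk, rfl⟩
    have h1 := key g hg
    have h2 := key k hk
    have h3 := aux_diam lam hl hs y β η hdiam _ _ (hin g hg) (hin k hk)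
    have h4 := aux_tensor_norm H x0 hx0 (∑ i, lam i • (g i).comp (auxJ H hmem u)
      - ∑ i, lam i • (k i).comp (auxJ H hmem u))
    have h5 : ∀ a b, dualTensorFunctional H x0 (a - b)
        = dualTensorFunctional H x0 a - dualTensorFunctional H x0 b := by
      intro a b; ext T; simp [dualTensorFunctional]
    rw [h5] at h4
    rw [← dist_eq_norm] at h1 h2 h4
    rw [dist_comm] at h2
    have t := dist_triangle4 (∑ i, lam i • g i) _ _ (∑ i, lam i • k i) |>.trans
      (add_le_add (add_le_add h1 h4) h2)
    linarith

/-- If `n(X*, f) = 1` then the slices of the ball of `X` given by `f` are norming. -/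
theorem aux_norming {X : Type*} [NormedAddCommGroup X] [NormedSpace ℝ X]
    (f : StrongDual ℝ X) (hf : ‖f‖ = 1) (hnf : nConstant (StrongDual ℝ X) f = 1)
    (g : StrongDual ℝ X) (c δ : ℝ) (hc : 0 < c) (hg : c < ‖g‖) (hδ : 0 < δ) :
    ∃ x : X, ‖x‖ ≤ 1 ∧ 1 - δ < f x ∧ c < |g x| := by
  have hgpos : 0 < ‖g‖ := hc.trans hg
  have hk : ∃ k : ℝ, c < k * ‖g‖ ∧ k * ‖g‖ ≤ ⨆ h : dualFace (StrongDual ℝ X) f, |h.1 g| := by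
    have hlt : c / ‖g‖ < nConstant (StrongDual ℝ X) f := by
      rw [hnf, div_lt_one hgpos]; exact hg
    unfold nConstant at hlt hnf
    obtain ⟨k, hk, hck⟩ := exists_lt_of_lt_csSup (by
      by_contra hne
      rw [Set.not_nonempty_iff_eq_empty] at hne
      rw [hne, Real.sSup_empty] at hnf
      norm_num at hnf) hlt
    exact ⟨k, by rwa [div_lt_iff₀ hgpos] at hck, hk.2 g⟩
  obtain ⟨k, hk1, hk2⟩ := hk
  have hlt := hk1.trans_le hk2
  have hh : ∃ h : dualFace (StrongDual ℝ X) f, c < |h.1 g| := by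
    rcases isEmpty_or_nonempty (dualFace (StrongDual ℝ X) f) with he | he
    · rw [Real.iSup_of_isEmpty] at hlt; linarith
    · exact exists_lt_of_lt_ciSup hlt
  obtain ⟨⟨h, hh1, hhf⟩, hhg⟩ := hh
  -- choose a sign
  have hsgn : ∃ s : ℝ, |s| = 1 ∧ c < s * h g := by
    rcases abs_cases (h g) with ⟨e, _⟩ | ⟨e, _⟩
    · exact ⟨1, by simp, by simp only at hhg; rw [e] at hhg; linarith⟩
    · exact ⟨-1, by simp, by simp only at hhg; rw [e] at hhg; linarith⟩
  obtain ⟨s, hs, hsc⟩ := hsgn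
  set t := δ / ‖g‖ with ht
  have htpos : 0 < t := by positivity
  have hnorm : 1 + t * c < ‖f + (t * s) • g‖ := by
    have h1 := h.le_opNorm (f + (t * s) • g)
    have h2 := le_abs_self (h (f + (t * s) • g))
    rw [Real.norm_eq_abs] at h1
    have h3 : h (f + (t * s) • g) = 1 + t * (s * h g) := by
      rw [map_add, map_smul, hhf, smul_eq_mul, mul_assoc]
    nlinarith [norm_nonneg (f + (t * s) • g)]
  have hx : ∃ x : X, ‖x‖ ≤ 1 ∧ 1 + t * c < f x + t * (s * g x) := by
    obtain ⟨x, hx, hxu⟩ := (f + (t * s) • g).exists_lt_apply_of_lt_opNorm hnorm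
    have e : ∀ x, (f + (t * s) • g) x = f x + t * (s * g x) := by
      intro x; simp [mul_assoc]
    rw [Real.norm_eq_abs, e] at hxu
    rcases abs_cases (f x + t * (s * g x)) with ⟨h, _⟩ | ⟨h, _⟩
    · exact ⟨x, hx.le, by rw [← h]; exact hxu⟩
    · refine ⟨-x, by rw [norm_neg]; exact hx.le, ?_⟩
      rw [map_neg, map_neg]; linarith
  obtain ⟨x, hx1, hx2⟩ := hx
  have hfx : f x ≤ 1 := by
    have := f.le_opNorm x
    rw [hf, one_mul] at this
    exact (le_abs_self _).trans (this.trans hx1)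
  have hsg : s * g x ≤ |g x| := by
    refine (le_abs_self _).trans ?_
    rw [abs_mul, hs, one_mul]
  have hgx : |g x| ≤ ‖g‖ := by
    have := g.le_opNorm x
    rw [Real.norm_eq_abs] at this
    nlinarith
  refine ⟨x, hx1, ?_, ?_⟩
  · have e : t * ‖g‖ = δ := by rw [ht]; field_simp
    have : t * (s * g x) ≤ t * ‖g‖ := mul_le_mul_of_nonneg_left (hsg.trans hgx) htpos.le
    nlinarith [mul_pos htpos hc]
  · refine lt_of_lt_of_le ?_ hsg
    have : t * c < t * (s * g x) := by linarith
    exact lt_of_mul_lt_mul_left this htpos.le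

theorem aux_attain {X Y : Type*} [NormedAddCommGroup X] [NormedSpace ℝ X]
    [NormedAddCommGroup Y] [NormedSpace ℝ Y]
    (f : StrongDual ℝ X) (hf : ‖f‖ = 1) (hnf : nConstant (StrongDual ℝ X) f = 1)
    (T : X →L[ℝ] Y) (c δ : ℝ) (hc : 0 < c) (hT : c < ‖T‖) (hδ : 0 < δ) :
    ∃ x : X, ‖x‖ ≤ 1 ∧ 1 - δ < f x ∧ c < ‖T x‖ := by
  obtain ⟨x, hx, hxT⟩ := T.exists_lt_apply_of_lt_opNorm hT
  obtain ⟨g, hg, hgx⟩ := exists_dual_vector'' ℝ (T x)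
  have h1 : c < ‖g.comp T‖ := by
    have := (g.comp T).le_opNorm x
    simp only [ContinuousLinearMap.comp_apply] at this
    rw [hgx] at this
    simp at this
    nlinarith [norm_nonneg (g.comp T)]
  obtain ⟨x', a, b, d⟩ := aux_norming f hf hnf (g.comp T) c δ hc h1 hδ
  refine ⟨x', a, b, d.trans_le ?_⟩
  have := g.le_opNorm (T x')
  rw [Real.norm_eq_abs] at this
  refine this.trans ?_
  nlinarith [norm_nonneg (T x')]

theorem aux_mp {X Y : Type*} [NormedAddCommGroup X] [NormedSpace ℝ X]
    [NormedAddCommGroup Y] [NormedSpace ℝ Y]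
    (f : StrongDual ℝ X) (hf : ‖f‖ = 1) (hnf : nConstant (StrongDual ℝ X) f = 1)
    (H : Submodule ℝ (X →L[ℝ] Y))
    (hmem : ∀ (g : StrongDual ℝ X) (y : Y), rankOneOp g y ∈ H)
    (hHp : WStarBallSCSProperty H) : WStarBallSCSProperty Y := by
  intro ε hε
  set η := ε / 4 with hη
  have hηpos : 0 < η := by positivity
  obtain ⟨n, lam, T, α, hl, hs, hT, hα, hdiam⟩ := hHp η hηpos
  have hex : ∀ i, ∃ x : X, ‖x‖ ≤ 1 ∧ 1 - η < f x ∧ 1 - α i < ‖(T i).1 x‖ := by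
    intro i
    refine aux_attain f hf hnf (T i).1 (1 - α i) η (by linarith [(hα i).2]) ?_ hηpos
    have : ‖(T i).1‖ = 1 := hT i
    rw [this]; linarith [(hα i).1]
  choose x hx1 hxf hxT using hex
  have hpos : ∀ i, 0 < ‖(T i).1 (x i)‖ := fun i => by linarith [hxT i, (hα i).2]
  have hle : ∀ i, ‖(T i).1 (x i)‖ ≤ 1 := fun i => by
    have h1 := (T i).1.le_opNorm (x i)
    have h2 : ‖(T i).1‖ = 1 := hT i
    rw [h2, one_mul] at h1
    exact h1.trans (hx1 i)
  refine ⟨n, lam, fun i => ‖(T i).1 (x i)‖⁻¹ • (T i).1 (x i),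
    fun i => 1 - (1 - α i) / ‖(T i).1 (x i)‖, hl, hs, ?_, ?_, ?_⟩
  · intro i
    rw [norm_smul, norm_inv, norm_norm, inv_mul_cancel₀ (hpos i).ne']
  · intro i
    have h1 : 0 < (1 - α i) / ‖(T i).1 (x i)‖ := div_pos (by linarith [(hα i).2]) (hpos i)
    have h2 : (1 - α i) / ‖(T i).1 (x i)‖ < 1 := by
      rw [div_lt_one (hpos i)]; exact hxT i
    constructor <;> linarith
  · have hin : ∀ g : Fin (n + 1) → StrongDual ℝ Y,
        (∀ i, ‖g i‖ ≤ 1 ∧ 1 - (1 - (1 - α i) / ‖(T i).1 (x i)‖)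
          < g i (‖(T i).1 (x i)‖⁻¹ • (T i).1 (x i))) →
        ∀ i, ‖dualTensorFunctional H (x i) (g i)‖ ≤ 1 ∧
          1 - α i < dualTensorFunctional H (x i) (g i) (T i) := by
      intro g hg i
      refine ⟨(aux_tensor_norm H (x i) (hx1 i) (g i)).trans (hg i).1, ?_⟩
      have h1 := (hg i).2
      rw [map_smul, smul_eq_mul, sub_sub_cancel, div_eq_inv_mul] at h1
      exact lt_of_mul_lt_mul_left h1 (inv_nonneg.2 (norm_nonneg _))
    refine (Metric.diam_le_of_forall_dist_le (C := 3 * η) (by positivity) ?_).trans_lt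
      (by linarith)
    rintro _ ⟨g, hg, rfl⟩ _ ⟨k, hk, rfl⟩
    have h1 := aux_diam lam hl hs T α η hdiam _ _ (hin g hg) (hin k hk)
    rw [dist_eq_norm]
    -- compare with the functional obtained through `f ⊗ y`
    have happ : ∀ g : Fin (n + 1) → StrongDual ℝ Y, (∀ i, ‖g i‖ ≤ 1) →
        ‖∑ i, lam i • g i - ∑ i, lam i • (f (x i) • g i)‖ ≤ η := by
      intro g hg
      apply aux_comb lam hl hs
      intro i
      have e : g i - f (x i) • g i = (1 - f (x i)) • g i := by rw [sub_smul, one_smul]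
      have hfx : f (x i) ≤ 1 := by
        have := f.le_opNorm (x i)
        rw [hf, one_mul] at this
        exact (le_abs_self _).trans (this.trans (hx1 i))
      rw [e, norm_smul, Real.norm_of_nonneg (by linarith)]
      nlinarith [hg i, hxf i, norm_nonneg (g i)]
    have a1 := happ g (fun i => (hg i).1)
    have a2 := happ k (fun i => (hk i).1)
    have a3 : ‖∑ i, lam i • (f (x i) • g i) - ∑ i, lam i • (f (x i) • k i)‖ ≤ η := by
      apply ContinuousLinearMap.opNorm_le_of_unit_norm hηpos.le
      intro y hy
      have h2 := ContinuousLinearMap.le_opNorm (∑ i, lam i • dualTensorFunctional H (x i) (g i)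
        - ∑ i, lam i • dualTensorFunctional H (x i) (k i)) ⟨rankOneOp f y, hmem f y⟩
      rw [aux_rank_norm, hf, hy, one_mul, mul_one] at h2
      refine le_trans (le_of_eq ?_) (h2.trans h1)
      congr 1
      simp [dualTensorFunctional, rankOneOp]
    rw [← dist_eq_norm] at a1 a2 a3
    rw [dist_comm] at a2
    rw [← dist_eq_norm]
    have t := dist_triangle4 (∑ i, lam i • g i) _ _ (∑ i, lam i • k i) |>.trans
      (add_le_add (add_le_add a1 a3) a2)
    linarith

/-- Corollary 2.18: if the norm of `X*` is non-rough and there is `f ∈ S_{X*}`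
with `n(X*, f) = 1`, then for every closed subspace `H` of `L(X, Y)` with `X* ⊗ Y ⊆ H`,
`H*` has the `w*`-BSCSP iff `Y*` has the `w*`-BSCSP. -/
theorem statement13 {X Y : Type*} [NormedAddCommGroup X] [NormedSpace ℝ X] [CompleteSpace X]
    [NormedAddCommGroup Y] [NormedSpace ℝ Y] [CompleteSpace Y]
    (hXs : NonRoughNorm (StrongDual ℝ X))
    (f : StrongDual ℝ X) (hf : ‖f‖ = 1) (hnf : nConstant (StrongDual ℝ X) f = 1)
    (H : Submodule ℝ (X →L[ℝ] Y)) (hH : IsClosed (H : Set (X →L[ℝ] Y)))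
    (hmem : ∀ (g : StrongDual ℝ X) (y : Y), rankOneOp g y ∈ H) :
    WStarBallSCSProperty H ↔ WStarBallSCSProperty Y := by
  exact ⟨aux_mp f hf hnf H hmem, aux_mpr hXs f hf H hmem⟩
end
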